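/- arXiv:2104.14858 — 2 statements merged into one kernel-verified Lean document; each statement's English description precedes it below -/
import Mathlib

section
/- (Unique ergodicity, equation (10), for the affine closed-loop system.) Let 𝒜 be a d×d real Schur matrix, β₁, …, β_L ∈ ℝ^d, W_ℓ(ξ) = 𝒜ξ + β_ℓ, and let p₁, …, p_L : ℝ^d → [0,1] be Dini continuous probability functions with Σ_ℓ p_ℓ(x) = 1 and p_ℓ(x) ≥ δ for some δ > 0 and all x. Let κ(x) = Σ_ℓ p_ℓ(x)·δ_{W_ℓ(x)} be the associated Markov kernel, let μ* be its (unique) invariant probability measure, and for x₀ ∈ ℝ^d let P_{x₀} be the law of the Markov chain (X(0), X(1), X(2), …) with X(0) = x₀ and transition kernel κ, given by the Ionescu–Tulcea construction on the path space (ℝ^d)^ℕ. Then for every x₀ ∈ ℝ^d and every bounded continuous f : ℝ^d → ℝ, P_{x₀}-almost surely the time averages (1/(k+1)) Σ_{j=0}^{k} f(X(j)) converge as k → ∞ to ∫ f dμ*; in particular the limit does not depend on x₀. -/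
open MeasureTheory Filter Topology

noncomputable section

/-- A real square matrix is Schur if every complex eigenvalue has modulus `< 1`. -/
def IsSchur {ι : Type*} [Fintype ι] [DecidableEq ι] (A : Matrix ι ι ℝ) : Prop :=
  ∀ z ∈ spectrum ℂ (A.map (fun x : ℝ => (x : ℂ))), ‖z‖ < 1

/-- `p` is Dini continuous: `|p x - p y| ≤ φ (dist x y)` for a nondecreasing modulus `φ` with
`φ 0 = 0` and `∫₀¹ φ t / t dt < ∞`. -/
def DiniContinuous {X : Type*} [PseudoMetricSpace X] (p : X → ℝ) : Prop :=
  ∃ φ : ℝ → ℝ, MonotoneOn φ (Set.Ici 0) ∧ φ 0 = 0 ∧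
    IntervalIntegrable (fun t => φ t / t) volume 0 1 ∧
    ∀ x y, |p x - p y| ≤ φ (dist x y)

/-- The Markov kernel `κ x = ∑ ℓ, p ℓ x • δ_{W ℓ x}` of an iterated random function given by
maps `W ℓ` chosen with place-dependent probabilities `p ℓ`. -/
def IFSKernel {X : Type*} [MeasurableSpace X] {L : ℕ}
    (p : Fin L → X → ℝ) (W : Fin L → X → X) (x : X) : Measure X :=
  ∑ ℓ, ENNReal.ofReal (p ℓ x) • Measure.dirac (W ℓ x)

/-- A measure `μ` is invariant for the kernel `κ` if `μ.bind κ = μ`. -/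
def Invariant {X : Type*} [MeasurableSpace X] (κ : X → Measure X) (μ : Measure X) : Prop :=
  μ.bind κ = μ

/-- A measure `μ` is attractive for the kernel `κ` if for every Borel probability measure `ν`,
the iterates `ν, ν.bind κ, (ν.bind κ).bind κ, …` converge weakly to `μ`. -/
def Attractive {X : Type*} [MeasurableSpace X] [TopologicalSpace X]
    (κ : X → Measure X) (μ : Measure X) : Prop :=
  ∀ ν : Measure X, IsProbabilityMeasure ν →
    ∀ f : BoundedContinuousFunction X ℝ,
      Tendsto (fun k => ∫ x, f x ∂((fun m : Measure X => m.bind κ)^[k] ν))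
        atTop (𝓝 (∫ x, f x ∂μ))

/-- The finite-dimensional distributions `(X 0, …, X n)` of the Markov chain with one-step
transition kernel `κ` started at the deterministic point `x₀`, defined inductively; by the
Ionescu–Tulcea theorem, these uniquely determine the law of the chain on the path space. -/
def fdd {X : Type*} [MeasurableSpace X] (κ : X → Measure X) (x₀ : X) :
    (n : ℕ) → Measure (Fin (n + 1) → X)
  | 0 => Measure.dirac (fun _ => x₀)
  | n + 1 => (fdd κ x₀ n).bind fun v => (κ (v (Fin.last n))).map (Fin.snoc v)

/-- `P` is the law (on the path space `ℕ → X`) of the Markov chain with transition kernel `κ`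
started at `x₀`, as given by the Ionescu–Tulcea construction: its finite-dimensional
distributions are the inductively defined ones. -/
def IsMarkovLaw {X : Type*} [MeasurableSpace X] (κ : X → Measure X) (x₀ : X)
    (P : Measure (ℕ → X)) : Prop :=
  IsProbabilityMeasure P ∧
    ∀ n : ℕ, P.map (fun ω (i : Fin (n + 1)) => ω (i : ℕ)) = fdd κ x₀ n


lemma dini_summable {φ : ℝ → ℝ} (hm : MonotoneOn φ (Set.Ici 0)) (h0 : φ 0 = 0)
    (hi : IntervalIntegrable (fun t => φ t / t) volume 0 1) {r : ℝ} (hr0 : 0 < r) (hr1 : r < 1) :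
    Summable (fun i : ℕ => φ (r ^ i)) := by
  have hnn : ∀ t, 0 ≤ t → 0 ≤ φ t := fun t ht => by
    rw [← h0]; exact hm (by simp) ht ht
  have hsub : ∀ a b, 0 ≤ a → a ≤ b → b ≤ 1 →
      IntervalIntegrable (fun t => φ t / t) volume a b := fun a b ha hab hb => by
    apply hi.mono_set
    rw [Set.uIcc_of_le hab, Set.uIcc_of_le zero_le_one]
    exact Set.Icc_subset_Icc ha hb
  have hp1 : ∀ i : ℕ, r ^ i ≤ 1 := fun i => pow_le_one₀ hr0.le hr1.le
  have hanti : ∀ i : ℕ, r ^ (i+1) ≤ r ^ i := fun i =>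
    pow_le_pow_of_le_one hr0.le hr1.le (Nat.le_succ i)
  have key : ∀ i : ℕ, (1 - r) * φ (r ^ (i+1)) ≤ ∫ t in (r^(i+1))..(r^i), φ t / t := by
    intro i
    have hpos : 0 < r ^ i := pow_pos hr0 i
    have hpos1 : 0 < r ^ (i+1) := pow_pos hr0 _
    have : ∫ t in (r^(i+1))..(r^i), φ (r^(i+1)) / r ^ i ≤ ∫ t in (r^(i+1))..(r^i), φ t / t := by
      apply intervalIntegral.integral_mono_on (hanti i) (by simp)
        (hsub _ _ hpos1.le (hanti i) (hp1 i))
      intro t ht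
      have ht0 : 0 < t := hpos1.trans_le ht.1
      exact div_le_div₀ (hnn t ht0.le) (hm hpos1.le ht0.le ht.1) ht0 ht.2
    refine le_trans (le_of_eq ?_) this
    rw [intervalIntegral.integral_const, smul_eq_mul]
    field_simp
    ring
  have hsum : ∀ n : ℕ, ∑ i ∈ Finset.range n, (∫ t in (r^(i+1))..(r^i), φ t / t)
      = ∫ t in (r^n)..1, φ t / t := by
    intro n
    induction n with
    | zero => simp
    | succ n ih =>
      rw [Finset.sum_range_succ, ih, add_comm]
      exact intervalIntegral.integral_add_adjacent_intervals
        (hsub _ _ (pow_pos hr0 _).le (hanti n) (hp1 n))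
        (hsub _ _ (pow_pos hr0 _).le (hp1 n) le_rfl)
  rw [← summable_nat_add_iff 1]
  have h1r : 0 < 1 - r := by linarith
  refine summable_of_sum_range_le (c := (∫ t in (0:ℝ)..1, φ t / t) / (1 - r))
    (fun n => hnn _ (pow_pos hr0 _).le) (fun n => ?_)
  rw [le_div_iff₀ h1r, mul_comm, Finset.mul_sum]
  refine (Finset.sum_le_sum fun i _ => key i).trans ?_
  rw [hsum]
  have := intervalIntegral.integral_add_adjacent_intervals
        (hsub 0 _ le_rfl (pow_pos hr0 n).le (hp1 n))
        (hsub _ _ (pow_pos hr0 n).le (hp1 n) le_rfl)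
  rw [← this]
  have : 0 ≤ ∫ t in (0:ℝ)..(r^n), φ t / t :=
    intervalIntegral.integral_nonneg (pow_pos hr0 n).le
      (fun t ht => div_nonneg (hnn t ht.1) ht.1)
  linarith

lemma dini_summable' {φ : ℝ → ℝ} (hm : MonotoneOn φ (Set.Ici 0)) (h0 : φ 0 = 0)
    (hi : IntervalIntegrable (fun t => φ t / t) volume 0 1) {r : ℝ} (hr0 : 0 < r) (hr1 : r < 1)
    {R : ℝ} (hR : 0 ≤ R) :
    Summable (fun i : ℕ => φ (R * r ^ i)) := by
  have hnn : ∀ t, 0 ≤ t → 0 ≤ φ t := fun t ht => by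
    rw [← h0]; exact hm (by simp) ht ht
  obtain ⟨k, hk⟩ : ∃ k : ℕ, R * r ^ k ≤ 1 := by
    have : Tendsto (fun k : ℕ => R * r ^ k) atTop (𝓝 (R * 0)) :=
      (tendsto_pow_atTop_nhds_zero_of_lt_one hr0.le hr1).const_mul R
    rw [mul_zero] at this
    exact ((this.eventually (gt_mem_nhds one_pos)).exists).imp fun _ h => h.le
  rw [← summable_nat_add_iff k]
  refine Summable.of_nonneg_of_le (fun i => hnn _ (by positivity)) (fun i => ?_)
    (dini_summable hm h0 hi hr0 hr1)
  apply hm (by simp; positivity) (by simp; positivity)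
  calc R * r ^ (i + k) = (R * r ^ k) * r ^ i := by ring
    _ ≤ 1 * r ^ i := by gcongr
    _ = _ := one_mul _

lemma dini_continuous {φ : ℝ → ℝ} (hm : MonotoneOn φ (Set.Ici 0)) (h0 : φ 0 = 0)
    (hi : IntervalIntegrable (fun t => φ t / t) volume 0 1) {X : Type*} [PseudoMetricSpace X]
    {p : X → ℝ} (hp : ∀ x y, |p x - p y| ≤ φ (dist x y)) : Continuous p := by
  rw [Metric.continuous_iff]
  intro b ε hε
  have hs := (dini_summable hm h0 hi (r := 1/2) (by norm_num) (by norm_num)).tendsto_atTop_zero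
  obtain ⟨k, hk⟩ := (hs.eventually (gt_mem_nhds hε)).exists
  refine ⟨(1/2)^k, by positivity, fun a ha => ?_⟩
  rw [Real.dist_eq]
  exact ((hp a b).trans (hm dist_nonneg (by simp) ha.le)).trans_lt hk

lemma pow_bound_of_schur {d : ℕ} (A : Matrix (Fin d) (Fin d) ℝ)
    (hA : ∀ z ∈ spectrum ℂ (A.map (fun x : ℝ => (x : ℂ))), ‖z‖ < 1) :
    ∃ r C : ℝ, 0 < r ∧ r < 1 ∧ 0 ≤ C ∧ ∀ (n : ℕ) (x : EuclideanSpace ℝ (Fin d)),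
      ‖((Matrix.toEuclideanLin A) ^ n) x‖ ≤ C * r ^ n * ‖x‖ := by
  let : NormedRing (Matrix (Fin d) (Fin d) ℂ) := Matrix.linftyOpNormedRing
  let : NormedAlgebra ℂ (Matrix (Fin d) (Fin d) ℂ) := Matrix.linftyOpNormedAlgebra
  set B := A.map (fun x : ℝ => (x : ℂ)) with hB
  have hcomp : CompleteSpace (Matrix (Fin d) (Fin d) ℂ) := FiniteDimensional.complete ℂ _
  have hρ : spectralRadius ℂ B < 1 := by
    rcases isEmpty_or_nonempty (Fin d) with h | h
    · have : Subsingleton (Matrix (Fin d) (Fin d) ℂ) := inferInstance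
      simp [spectralRadius, spectrum.of_subsingleton]
    · have := spectrum.spectralRadius_lt_of_forall_lt B (r := 1) (fun z hz => hA z hz)
      simpa using this
  obtain ⟨r, hr, hr1⟩ := ENNReal.lt_iff_exists_nnreal_btwn.1 hρ
  have hr1' : r < 1 := by exact_mod_cast hr1
  have hr0 : 0 < r := by
    have := lt_of_le_of_lt (zero_le) hr
    exact_mod_cast this
  have hev := (spectrum.pow_nnnorm_pow_one_div_tendsto_nhds_spectralRadius B).eventually
    (gt_mem_nhds hr)
  have hev2 : ∀ᶠ n : ℕ in atTop, ‖B ^ n‖ ≤ (r:ℝ) ^ n := by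
    filter_upwards [hev, eventually_gt_atTop 0] with n hn hn0
    have h2 : ((‖B ^ n‖₊ : ENNReal)) ≤ (r : ENNReal) ^ n := by
      have := ENNReal.rpow_le_rpow hn.le (z := n) (by positivity)
      rwa [← ENNReal.rpow_mul, one_div, inv_mul_cancel₀ (by positivity), ENNReal.rpow_one,
        ENNReal.rpow_natCast] at this
    exact_mod_cast h2
  obtain ⟨N, hN⟩ := eventually_atTop.1 hev2
  have hr0' : (0:ℝ) < r := by exact_mod_cast hr0
  have hb : ∃ C : ℝ, 0 ≤ C ∧ ∀ n, ‖B ^ n‖ ≤ C * (r:ℝ) ^ n := by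
    refine ⟨1 + ∑ i ∈ Finset.range N, ‖B ^ i‖ / (r:ℝ)^i, by positivity, fun n => ?_⟩
    have hS : 0 ≤ ∑ i ∈ Finset.range N, ‖B ^ i‖ / (r:ℝ)^i := by positivity
    rcases lt_or_ge n N with h | h
    · have := Finset.single_le_sum (f := fun i => ‖B ^ i‖ / (r:ℝ)^i)
        (fun i _ => by positivity) (Finset.mem_range.2 h)
      rw [← div_le_iff₀ (by positivity)]
      linarith
    · refine (hN n h).trans ?_
      nlinarith [pow_pos hr0' n]
  obtain ⟨C, hC0, hC⟩ := hb
  have hent : ∀ n i j, |(A ^ n) i j| ≤ C * (r:ℝ)^n := by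
    intro n i j
    refine le_trans ?_ (hC n)
    have hBn : B ^ n = (A ^ n).map (fun x : ℝ => (x : ℂ)) := by
      have := (map_pow (Complex.ofRealHom.mapMatrix (m := Fin d)) A n)
      exact this.symm
    have h1 : |(A^n) i j| = ‖(B^n) i j‖ := by
      rw [hBn]; simp
    rw [h1, Matrix.linfty_opNorm_def]
    have h2 : ‖(B^n) i j‖₊ ≤ ∑ j, ‖(B^n) i j‖₊ :=
      Finset.single_le_sum (f := fun j => ‖(B^n) i j‖₊) (fun _ _ => zero_le) (Finset.mem_univ j)
    have h3 : ∑ j, ‖(B^n) i j‖₊ ≤ Finset.univ.sup fun i => ∑ j, ‖(B^n) i j‖₊ :=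
      Finset.le_sup (f := fun i => ∑ j, ‖(B^n) i j‖₊) (Finset.mem_univ i)
    exact_mod_cast h2.trans h3
  refine ⟨r, d * (d * C), hr0', by exact_mod_cast hr1', by positivity, fun n x => ?_⟩
  have hpow : (Matrix.toEuclideanLin A) ^ n = Matrix.toEuclideanLin (A ^ n) := by
    exact (Matrix.toLpLin_pow _ A n).symm
  rw [hpow]
  have hcoord : ∀ i, ‖(Matrix.toEuclideanLin (A ^ n) x) i‖ ≤ d * C * r ^ n * ‖x‖ := by
    intro i
    rw [Matrix.toLpLin_apply]
    simp only [Matrix.mulVec, dotProduct]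
    refine (norm_sum_le _ _).trans ?_
    have : ∀ j ∈ Finset.univ, ‖(A ^ n) i j * x.ofLp j‖ ≤ C * r ^ n * ‖x‖ := fun j _ => by
      rw [norm_mul]
      exact mul_le_mul (hent n i j) (PiLp.norm_apply_le x j) (norm_nonneg _) (by positivity)
    refine (Finset.sum_le_card_nsmul _ _ _ this).trans (le_of_eq ?_)
    simp; ring
  have hn : ‖Matrix.toEuclideanLin (A ^ n) x‖ ≤ ∑ i, ‖(Matrix.toEuclideanLin (A ^ n) x) i‖ := by
    set y := Matrix.toEuclideanLin (A ^ n) x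
    have : y = ∑ i, EuclideanSpace.single i (y i) := by
      ext j; simp [Finset.sum_apply, Pi.single_apply]
    conv_lhs => rw [this]
    refine (norm_sum_le _ _).trans (le_of_eq ?_)
    simp
  refine hn.trans ?_
  refine (Finset.sum_le_card_nsmul _ _ _ (fun i _ => hcoord i)).trans (le_of_eq ?_)
  simp; ring

noncomputable def TT {X : Type*} {L : ℕ} (p : Fin L → X → ℝ) (W : Fin L → X → X) (g : X → ℝ) : X → ℝ :=
  fun x => ∑ ℓ, p ℓ x * g (W ℓ x)

lemma one_step {X : Type*} {L : ℕ} {p : Fin L → X → ℝ} {W : Fin L → X → X} {g : X → ℝ}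
    {x y : X} {m D e θ : ℝ} (hs : ∀ x, ∑ ℓ, p ℓ x = 1)
    (hx : ∀ ℓ, m ≤ g (W ℓ x) ∧ g (W ℓ x) ≤ m + D)
    (hy : ∀ ℓ, m ≤ g (W ℓ y) ∧ g (W ℓ y) ≤ m + D)
    (he : ∀ ℓ, |g (W ℓ x) - g (W ℓ y)| ≤ e) (heD : e ≤ D)
    (hp : ∀ ℓ x, 0 ≤ p ℓ x)
    (hθ : 1 - ∑ ℓ, min (p ℓ x) (p ℓ y) ≤ θ) :
    |TT p W g x - TT p W g y| ≤ (1 - θ) * e + θ * D := by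
  set q : Fin L → ℝ := fun ℓ => min (p ℓ x) (p ℓ y) with hq
  set s := ∑ ℓ, q ℓ with hsdef
  have hq0 : ∀ ℓ, 0 ≤ q ℓ := fun ℓ => le_min (hp ℓ x) (hp ℓ y)
  have hqx : ∀ ℓ, 0 ≤ p ℓ x - q ℓ := fun ℓ => sub_nonneg.2 (min_le_left _ _)
  have hqy : ∀ ℓ, 0 ≤ p ℓ y - q ℓ := fun ℓ => sub_nonneg.2 (min_le_right _ _)
  have hdec : TT p W g x - TT p W g y = ∑ ℓ, q ℓ * (g (W ℓ x) - g (W ℓ y)) +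
      (∑ ℓ, (p ℓ x - q ℓ) * g (W ℓ x) - ∑ ℓ, (p ℓ y - q ℓ) * g (W ℓ y)) := by
    simp only [TT]
    rw [← Finset.sum_sub_distrib, ← Finset.sum_sub_distrib, ← Finset.sum_add_distrib]
    exact Finset.sum_congr rfl fun ℓ _ => by ring
  have h1 : |∑ ℓ, q ℓ * (g (W ℓ x) - g (W ℓ y))| ≤ s * e := by
    refine (Finset.abs_sum_le_sum_abs _ _).trans ?_
    rw [hsdef, Finset.sum_mul]
    refine Finset.sum_le_sum fun ℓ _ => ?_
    rw [abs_mul, abs_of_nonneg (hq0 ℓ)]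
    exact mul_le_mul_of_nonneg_left (he ℓ) (hq0 ℓ)
  have ux : ∑ ℓ, (p ℓ x - q ℓ) = 1 - s := by rw [Finset.sum_sub_distrib, hs]
  have uy : ∑ ℓ, (p ℓ y - q ℓ) = 1 - s := by rw [Finset.sum_sub_distrib, hs]
  have bnd : ∀ (a b : Fin L → ℝ) , (∀ ℓ, 0 ≤ a ℓ) → (∀ ℓ, m ≤ b ℓ ∧ b ℓ ≤ m + D) →
      ∑ ℓ, a ℓ = 1 - s → (1 - s) * m ≤ ∑ ℓ, a ℓ * b ℓ ∧ ∑ ℓ, a ℓ * b ℓ ≤ (1 - s) * (m + D) := by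
    intro a b ha hb hsum
    rw [← hsum, Finset.sum_mul, Finset.sum_mul]
    exact ⟨Finset.sum_le_sum fun ℓ _ => mul_le_mul_of_nonneg_left (hb ℓ).1 (ha ℓ),
      Finset.sum_le_sum fun ℓ _ => mul_le_mul_of_nonneg_left (hb ℓ).2 (ha ℓ)⟩
  obtain ⟨a1, a2⟩ := bnd _ _ hqx hx ux
  obtain ⟨b1, b2⟩ := bnd _ _ hqy hy uy
  rw [hdec]
  have h2 : |∑ ℓ, (p ℓ x - q ℓ) * g (W ℓ x) - ∑ ℓ, (p ℓ y - q ℓ) * g (W ℓ y)| ≤ (1 - s) * D := by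
    rw [abs_le]; constructor <;> nlinarith
  refine (abs_add_le _ _).trans ((add_le_add h1 h2).trans ?_)
  nlinarith

lemma TT_range {X : Type*} {L : ℕ} {p : Fin L → X → ℝ} {W : Fin L → X → X} {g : X → ℝ}
    {K : Set X} {a b : ℝ} (hs : ∀ x, ∑ ℓ, p ℓ x = 1) (hp : ∀ ℓ x, 0 ≤ p ℓ x)
    (hK : ∀ x ∈ K, ∀ ℓ, W ℓ x ∈ K)
    (hg : ∀ x ∈ K, a ≤ g x ∧ g x ≤ b) : ∀ x ∈ K, a ≤ TT p W g x ∧ TT p W g x ≤ b := by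
  intro x hx
  constructor
  · calc a = ∑ ℓ, p ℓ x * a := by rw [← Finset.sum_mul, hs, one_mul]
      _ ≤ _ := Finset.sum_le_sum fun ℓ _ =>
        mul_le_mul_of_nonneg_left (hg _ (hK x hx ℓ)).1 (hp ℓ x)
  · calc _ ≤ ∑ ℓ, p ℓ x * b := Finset.sum_le_sum fun ℓ _ =>
          mul_le_mul_of_nonneg_left (hg _ (hK x hx ℓ)).2 (hp ℓ x)
      _ = b := by rw [← Finset.sum_mul, hs, one_mul]

lemma TT_iter_range {X : Type*} {L : ℕ} {p : Fin L → X → ℝ} {W : Fin L → X → X} {g : X → ℝ}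
    {K : Set X} {a b : ℝ} (hs : ∀ x, ∑ ℓ, p ℓ x = 1) (hp : ∀ ℓ x, 0 ≤ p ℓ x)
    (hK : ∀ x ∈ K, ∀ ℓ, W ℓ x ∈ K)
    (hg : ∀ x ∈ K, a ≤ g x ∧ g x ≤ b) (n : ℕ) :
    ∀ x ∈ K, a ≤ (TT p W)^[n] g x ∧ (TT p W)^[n] g x ≤ b := by
  induction n with
  | zero => simpa using hg
  | succ n ih => rw [Function.iterate_succ_apply']; exact TT_range hs hp hK ih

lemma TT_cont {X : Type*} [TopologicalSpace X] {L : ℕ} {p : Fin L → X → ℝ} {W : Fin L → X → X}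
    {g : X → ℝ} (hp : ∀ ℓ, Continuous (p ℓ)) (hW : ∀ ℓ, Continuous (W ℓ)) (hg : Continuous g) :
    Continuous (TT p W g) := by
  unfold TT
  exact continuous_finsetSum _ fun ℓ _ => (hp ℓ).mul (hg.comp (hW ℓ))

lemma TT_iter_cont {X : Type*} [TopologicalSpace X] {L : ℕ} {p : Fin L → X → ℝ}
    {W : Fin L → X → X}
    {g : X → ℝ} (hp : ∀ ℓ, Continuous (p ℓ)) (hW : ∀ ℓ, Continuous (W ℓ)) (hg : Continuous g)
    (n : ℕ) : Continuous ((TT p W)^[n] g) := by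
  induction n with
  | zero => simpa using hg
  | succ n ih => rw [Function.iterate_succ_apply']; exact TT_cont hp hW ih

/-- iterated coupling; `S i x y` says the pair has already been contracted `i` times. -/
lemma iter_step {X : Type*} {L : ℕ} {p : Fin L → X → ℝ} {W : Fin L → X → X} {g : X → ℝ}
    {K : Set X} {m D e : ℝ} {θ : ℕ → ℝ} {S : ℕ → X → X → Prop}
    (hs : ∀ x, ∑ ℓ, p ℓ x = 1) (hp : ∀ ℓ x, 0 ≤ p ℓ x)
    (hK : ∀ x ∈ K, ∀ ℓ, W ℓ x ∈ K)
    (hg : ∀ x ∈ K, m ≤ g x ∧ g x ≤ m + D)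
    (hS : ∀ i x y, S i x y → ∀ ℓ, S (i+1) (W ℓ x) (W ℓ y))
    (hθ : ∀ i x y, S i x y → 1 - ∑ ℓ, min (p ℓ x) (p ℓ y) ≤ θ i)
    (hθ1 : ∀ i, θ i ≤ 1)
    (heD : e ≤ D) (n : ℕ) :
    ∀ i, (∀ x ∈ K, ∀ y ∈ K, S (i + n) x y → |g x - g y| ≤ e) →
      ∀ x ∈ K, ∀ y ∈ K, S i x y → |(TT p W)^[n] g x - (TT p W)^[n] g y| ≤
        (∏ j ∈ Finset.range n, (1 - θ (i + j))) * e
          + (1 - ∏ j ∈ Finset.range n, (1 - θ (i + j))) * D := by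
  induction n with
  | zero =>
    intro i h x hx y hy hxy
    simpa using h x hx y hy hxy
  | succ n ih =>
    intro i h x hx y hy hxy
    rw [Function.iterate_succ_apply']
    have ih' := ih (i+1) (by rwa [show i + 1 + n = i + (n+1) by ring])
    set Q := ∏ j ∈ Finset.range n, (1 - θ (i + 1 + j)) with hQ
    have hQ0 : 0 ≤ Q := Finset.prod_nonneg fun j _ => by linarith [hθ1 (i+1+j)]
    have hR := TT_iter_range hs hp hK hg n
    have := one_step (p := p) (W := W) (g := (TT p W)^[n] g) (x := x) (y := y) (m := m) (D := D)
      (e := Q * e + (1 - Q) * D) (θ := θ i) hs (fun ℓ => hR _ (hK x hx ℓ))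
      (fun ℓ => hR _ (hK y hy ℓ))
      (fun ℓ => ih' _ (hK x hx ℓ) _ (hK y hy ℓ) (hS i x y hxy ℓ)) (by nlinarith) hp
      (hθ i x y hxy)
    rw [Finset.prod_range_succ']
    have hQ' : ∏ k ∈ Finset.range n, (1 - θ (i + (k + 1))) = Q :=
      Finset.prod_congr rfl fun k _ => by rw [show i + (k+1) = i + 1 + k by ring]
    rw [hQ', add_zero]
    refine this.trans (le_of_eq ?_)
    ring

lemma prod_lower {θ : ℕ → ℝ} {δ : ℝ} (hδ : 0 < δ) (hθ0 : ∀ i, 0 ≤ θ i) (hθ1 : ∀ i, θ i ≤ 1 - δ)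
    (hsum : Summable θ) (n : ℕ) :
    Real.exp (-(∑' i, θ i) / δ) ≤ ∏ j ∈ Finset.range n, (1 - θ j) := by
  have h1 : ∀ j, Real.exp (-(θ j) / δ) ≤ 1 - θ j := fun j => by
    have hpos : 0 < 1 - θ j := by linarith [hθ1 j]
    rw [neg_div, Real.exp_neg, inv_le_comm₀ (Real.exp_pos _) hpos]
    have h2 : (1 - θ j)⁻¹ = θ j / (1 - θ j) + 1 := by field_simp; ring
    rw [h2]
    refine le_trans ?_ (Real.add_one_le_exp _)
    have : θ j / (1 - θ j) ≤ θ j / δ := div_le_div_of_nonneg_left (hθ0 j) hδ (by linarith [hθ1 j])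
    linarith
  calc _ ≤ Real.exp (∑ j ∈ Finset.range n, (-(θ j) / δ)) := by
        apply Real.exp_le_exp.2
        rw [← Finset.sum_div, Finset.sum_neg_distrib]
        have := hsum.sum_le_tsum (Finset.range n) (fun i _ => hθ0 i)
        gcongr
    _ = ∏ j ∈ Finset.range n, Real.exp (-(θ j) / δ) := Real.exp_sum _ _
    _ ≤ _ := Finset.prod_le_prod (fun _ _ => (Real.exp_pos _).le) (fun j _ => h1 j)

lemma osc_tendsto {X : Type*} {L : ℕ} {p : Fin L → X → ℝ} {W : Fin L → X → X} {f : X → ℝ}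
    {K : Set X} {B δ : ℝ} {θ : ℕ → ℝ} {S : ℕ → X → X → Prop} (hδ : 0 < δ)
    (hs : ∀ x, ∑ ℓ, p ℓ x = 1) (hp : ∀ ℓ x, 0 ≤ p ℓ x)
    (hK : ∀ x ∈ K, ∀ ℓ, W ℓ x ∈ K)
    (hf : ∀ x ∈ K, |f x| ≤ B)
    (hS0 : ∀ x ∈ K, ∀ y ∈ K, S 0 x y)
    (hS : ∀ i x y, S i x y → ∀ ℓ, S (i+1) (W ℓ x) (W ℓ y))
    (hθ : ∀ i x y, S i x y → 1 - ∑ ℓ, min (p ℓ x) (p ℓ y) ≤ θ i)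
    (hθ0 : ∀ i, 0 ≤ θ i) (hθ1 : ∀ i, θ i ≤ 1 - δ) (hsum : Summable θ)
    (hunif : ∀ m, ∀ ε > 0, ∃ n, ∀ x ∈ K, ∀ y ∈ K, S n x y →
      |(TT p W)^[m] f x - (TT p W)^[m] f y| ≤ ε) (η : ℝ) (hη : 0 < η) :
    ∃ N, ∀ n ≥ N, ∀ x ∈ K, ∀ y ∈ K, |(TT p W)^[n] f x - (TT p W)^[n] f y| ≤ η := by
  rcases K.eq_empty_or_nonempty with rfl | ⟨x0, hx0⟩
  · exact ⟨0, by simp⟩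
  have hB : 0 ≤ B := (abs_nonneg _).trans (hf x0 hx0)
  set c := Real.exp (-(∑' i, θ i) / δ) with hc
  have hc0 : 0 < c := Real.exp_pos _
  have hc1 : c ≤ 1 := by
    rw [hc]; apply Real.exp_le_one_iff.2
    exact div_nonpos_of_nonpos_of_nonneg (neg_nonpos.2 (tsum_nonneg hθ0)) hδ.le
  have main : ∀ k : ℕ, ∃ N, ∃ a, ∀ x ∈ K, a ≤ (TT p W)^[N] f x ∧
      (TT p W)^[N] f x ≤ a + (η/2 + (1-c)^k * (2 * B)) := by
    intro k
    induction k with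
    | zero =>
      refine ⟨0, -B, fun x hx => ?_⟩
      have := abs_le.1 (hf x hx)
      simp only [Function.iterate_zero, id_eq, pow_zero, one_mul]
      constructor <;> linarith
    | succ k ih =>
      obtain ⟨N, a, h⟩ := ih
      set D := η/2 + (1-c)^k * (2 * B) with hD
      have hD2 : 0 ≤ (1-c)^k * (2*B) := by
        have : 0 ≤ 1 - c := by linarith
        positivity
      have hε : 0 < c * (η/2) := by positivity
      obtain ⟨n, hn⟩ := hunif N _ hε
      have hst := iter_step (θ := θ) (S := S) (e := c * (η/2)) hs hp hK h hS hθ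
        (fun i => by linarith [hθ1 i]) (by nlinarith) n 0 (by simpa using hn)
      have hpair : ∀ x ∈ K, ∀ y ∈ K, |(TT p W)^[n+N] f x - (TT p W)^[n+N] f y| ≤
          η/2 + (1-c)^(k+1) * (2 * B) := by
        intro x hx y hy
        rw [Function.iterate_add_apply]
        refine (hst x hx y hy (hS0 x hx y hy)).trans ?_
        have hpl := prod_lower hδ hθ0 hθ1 hsum n
        have hpu : ∏ j ∈ Finset.range n, (1 - θ j) ≤ 1 :=
          Finset.prod_le_one (fun j _ => by linarith [hθ1 j]) (fun j _ => by linarith [hθ0 j])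
        simp only [zero_add]
        rw [← hc] at hpl
        set Q := ∏ j ∈ Finset.range n, (1 - θ j)
        have e1 : Q * (c * (η/2)) ≤ c * (η/2) := by nlinarith
        have e2 : (1 - Q) * D ≤ (1 - c) * D := by nlinarith
        have e3 : c * (η/2) + (1 - c) * D = η/2 + (1-c)^(k+1) * (2 * B) := by rw [hD]; ring
        linarith
      refine ⟨n + N, sInf ((TT p W)^[n+N] f '' K), fun x hx => ⟨?_, ?_⟩⟩
      · refine csInf_le ⟨(TT p W)^[n+N] f x - (η/2 + (1-c)^(k+1) * (2 * B)), ?_⟩ ⟨x, hx, rfl⟩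
        rintro _ ⟨y, hy, rfl⟩
        linarith [(abs_le.1 (hpair x hx y hy)).2]
      · rw [← sub_le_iff_le_add]
        refine le_csInf ⟨_, x, hx, rfl⟩ ?_
        rintro _ ⟨y, hy, rfl⟩
        linarith [(abs_le.1 (hpair x hx y hy)).2]
  have hlim : Tendsto (fun k : ℕ => (1-c)^k * (2*B)) atTop (𝓝 (0 * (2*B))) :=
    (tendsto_pow_atTop_nhds_zero_of_lt_one (by linarith) (by linarith)).mul_const _
  rw [zero_mul] at hlim
  obtain ⟨k, hk⟩ := (hlim.eventually (gt_mem_nhds (half_pos hη))).exists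
  obtain ⟨N, a, h⟩ := main k
  refine ⟨N, fun n hn x hx y hy => ?_⟩
  obtain ⟨j, rfl⟩ := Nat.exists_eq_add_of_le' hn
  rw [Function.iterate_add_apply]
  have hR := TT_iter_range hs hp hK h j
  rw [abs_le]
  have h1 := hR x hx
  have h2 := hR y hy
  constructor <;> linarith [h1.1, h1.2, h2.1, h2.2]

lemma meas_sum_dirac {Y X : Type*} [MeasurableSpace X] [MeasurableSpace Y] {L : ℕ}
    {a : Fin L → Y → ℝ} {b : Fin L → Y → X} (ha : ∀ ℓ, Measurable (a ℓ))
    (hb : ∀ ℓ, Measurable (b ℓ)) :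
    Measurable (fun v => ∑ ℓ, ENNReal.ofReal (a ℓ v) • Measure.dirac (b ℓ v)) := by
  refine Measure.measurable_of_measurable_coe _ fun s hs => ?_
  simp only [Measure.coe_finsetSum, Finset.sum_apply, Measure.smul_apply, smul_eq_mul,
    Measure.dirac_apply' _ hs]
  refine Finset.measurable_sum _ fun ℓ _ => ?_
  exact (ha ℓ).ennreal_ofReal.mul ((measurable_one.indicator hs).comp (hb ℓ))

lemma IFS_meas {X : Type*} [MeasurableSpace X] {L : ℕ} {p : Fin L → X → ℝ} {W : Fin L → X → X}
    (hp : ∀ ℓ, Measurable (p ℓ)) (hW : ∀ ℓ, Measurable (W ℓ)) : Measurable (IFSKernel p W) :=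
  meas_sum_dirac hp hW

lemma lintegral_sum_dirac {X : Type*} [MeasurableSpace X] {L : ℕ}
    (a : Fin L → ℝ) (b : Fin L → X) {g : X → ENNReal} (hg : Measurable g) :
    ∫⁻ y, g y ∂(∑ ℓ, ENNReal.ofReal (a ℓ) • Measure.dirac (b ℓ))
      = ∑ ℓ, ENNReal.ofReal (a ℓ) * g (b ℓ) := by
  rw [lintegral_finsetSum_measure]
  refine Finset.sum_congr rfl fun ℓ _ => ?_
  rw [lintegral_smul_measure, lintegral_dirac' _ hg, smul_eq_mul]

lemma meas_snoc {X : Type*} [MeasurableSpace X] (n : ℕ) :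
    Measurable (fun z : (Fin (n+1) → X) × X => (Fin.snoc z.1 z.2 : Fin (n+2) → X)) := by
  refine measurable_pi_iff.2 fun i => ?_
  refine Fin.lastCases ?_ (fun j => ?_) i
  · simpa using measurable_snd
  · simp only [Fin.snoc_castSucc]
    exact (measurable_pi_apply j).comp measurable_fst

lemma map_IFS {X Y : Type*} [MeasurableSpace X] [MeasurableSpace Y] {L : ℕ} {p : Fin L → X → ℝ}
    {W : Fin L → X → X} (x : X) {h : X → Y} (hh : Measurable h) :
    (IFSKernel p W x).map h = ∑ ℓ, ENNReal.ofReal (p ℓ x) • Measure.dirac (h (W ℓ x)) := by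
  ext s hs
  rw [Measure.map_apply hh hs, IFSKernel]
  simp only [Measure.coe_finsetSum, Finset.sum_apply, Measure.smul_apply, smul_eq_mul,
    Measure.dirac_apply' _ hs, Measure.dirac_apply' _ (hh hs)]
  rfl

lemma markov_step {X : Type*} [MeasurableSpace X] {L : ℕ} {p : Fin L → X → ℝ} {W : Fin L → X → X}
    (hp : ∀ ℓ, Measurable (p ℓ)) (hW : ∀ ℓ, Measurable (W ℓ)) {x₀ : X} {P : Measure (ℕ → X)}
    (hP : IsMarkovLaw (IFSKernel p W) x₀ P) (n : ℕ) {G : (Fin (n+1) → X) → X → ENNReal}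
    (hG : Measurable (Function.uncurry G)) :
    ∫⁻ ω, G (fun i => ω i) (ω (n+1)) ∂P
      = ∫⁻ ω, ∑ ℓ, ENNReal.ofReal (p ℓ (ω n)) * G (fun i => ω i) (W ℓ (ω n)) ∂P := by
  have hπ : ∀ n : ℕ, Measurable (fun (ω : ℕ → X) (i : Fin (n + 1)) => ω (i : ℕ)) := fun n =>
    measurable_pi_iff.2 fun i => measurable_pi_apply _
  have hlast : Measurable (fun v : Fin (n+1) → X => v (Fin.last n)) := measurable_pi_apply _
  set H : (Fin (n+2) → X) → ENNReal := fun v => G (fun i => v i.castSucc) (v (Fin.last (n+1)))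
  have hH : Measurable H := by
    have : Measurable (fun v : Fin (n+2) → X =>
        ((fun i : Fin (n+1) => v i.castSucc), v (Fin.last (n+1)))) :=
      (measurable_pi_iff.2 fun i => measurable_pi_apply _).prodMk (measurable_pi_apply _)
    exact hG.comp this
  have h1 : ∫⁻ ω, G (fun i => ω i) (ω (n+1)) ∂P = ∫⁻ v, H v ∂(fdd (IFSKernel p W) x₀ (n+1)) := by
    rw [← hP.2 (n+1), lintegral_map hH (hπ _)]
    simp [H]
  have hsn : ∀ v : Fin (n+1) → X, Measurable (fun y => (Fin.snoc v y : Fin (n+2) → X)) := fun v =>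
    (meas_snoc n).comp (measurable_const.prodMk measurable_id)
  have hker : (fun v : Fin (n+1) → X => (IFSKernel p W (v (Fin.last n))).map
      (fun y => (Fin.snoc v y : Fin (n+2) → X))) = fun v => ∑ ℓ, ENNReal.ofReal (p ℓ (v (Fin.last n))) •
        Measure.dirac (Fin.snoc v (W ℓ (v (Fin.last n))) : Fin (n+2) → X) := by
    funext v
    exact map_IFS _ (hsn v)
  have hkm : Measurable (fun v : Fin (n+1) → X => ∑ ℓ, ENNReal.ofReal (p ℓ (v (Fin.last n))) •
        Measure.dirac (Fin.snoc v (W ℓ (v (Fin.last n))) : Fin (n+2) → X)) :=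
    meas_sum_dirac (fun ℓ => (hp ℓ).comp hlast)
      (fun ℓ => (meas_snoc n).comp (measurable_id.prodMk ((hW ℓ).comp hlast)))
  have h2 : fdd (IFSKernel p W) x₀ (n+1) = (fdd (IFSKernel p W) x₀ n).bind
      (fun v => ∑ ℓ, ENNReal.ofReal (p ℓ (v (Fin.last n))) •
        Measure.dirac (Fin.snoc v (W ℓ (v (Fin.last n))) : Fin (n+2) → X)) := by
    rw [← hker]; rfl
  rw [h1, h2, Measure.lintegral_bind hkm.aemeasurable hH.aemeasurable]
  simp_rw [lintegral_sum_dirac _ _ hH]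
  rw [← hP.2 n, lintegral_map _ (hπ n)]
  · simp [H]
  · refine Finset.measurable_sum _ fun ℓ _ => ?_
    exact ((hp ℓ).comp hlast).ennreal_ofReal.mul (hH.comp ((meas_snoc n).comp
      (measurable_id.prodMk ((hW ℓ).comp hlast))))

lemma markov_mem {X : Type*} [MeasurableSpace X] {L : ℕ} {p : Fin L → X → ℝ} {W : Fin L → X → X}
    (hp : ∀ ℓ, Measurable (p ℓ)) (hW : ∀ ℓ, Measurable (W ℓ)) {x₀ : X} {P : Measure (ℕ → X)}
    (hP : IsMarkovLaw (IFSKernel p W) x₀ P) {K : Set X} (hKm : MeasurableSet K)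
    (hK : ∀ x ∈ K, ∀ ℓ, W ℓ x ∈ K) (hx₀ : x₀ ∈ K) : ∀ᵐ ω ∂P, ∀ n, ω n ∈ K := by
  rw [ae_all_iff]
  intro n
  have hms : ∀ n : ℕ, MeasurableSet {ω : ℕ → X | ω n ∈ Kᶜ} := fun n =>
    (measurable_pi_apply n) hKm.compl
  induction n with
  | zero =>
    have h0 := hP.2 0
    have hπ : Measurable (fun (ω : ℕ → X) (i : Fin (0 + 1)) => ω (i : ℕ)) :=
      measurable_pi_iff.2 fun i => measurable_pi_apply _
    have hs : MeasurableSet {v : Fin (0+1) → X | v 0 ∈ Kᶜ} := (measurable_pi_apply _) hKm.compl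
    have h1 : P {ω | ω 0 ∈ Kᶜ} = 0 := by
      have : (P.map (fun ω (i : Fin (0 + 1)) => ω (i : ℕ))) {v | v 0 ∈ Kᶜ} = 0 := by
        rw [h0, fdd, Measure.dirac_apply' _ hs]
        simp [hx₀]
      rw [Measure.map_apply hπ hs] at this
      simpa using this
    rw [ae_iff]; simpa using h1
  | succ n ih =>
    have hG : Measurable (Function.uncurry
        (fun (_ : Fin (n+1) → X) (y : X) => Kᶜ.indicator (1 : X → ENNReal) y)) :=
      (measurable_one.indicator hKm.compl).comp measurable_snd
    have := markov_step hp hW hP n hG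
    have hz : ∫⁻ ω, ∑ ℓ, ENNReal.ofReal (p ℓ (ω n)) *
        Kᶜ.indicator (1 : X → ENNReal) (W ℓ (ω n)) ∂P = 0 := by
      rw [← lintegral_zero (μ := P)]
      apply lintegral_congr_ae
      filter_upwards [ih] with ω hω
      refine Finset.sum_eq_zero fun ℓ _ => ?_
      simp [hK _ hω ℓ]
    rw [hz] at this
    have h2 : ∫⁻ ω : ℕ → X, {ω : ℕ → X | ω (n+1) ∈ Kᶜ}.indicator (1 : (ℕ → X) → ENNReal) ω ∂P = 0 := by
      rw [← this]; rfl
    rw [lintegral_indicator_one (hms _)] at h2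
    rw [ae_iff]; simpa using h2

lemma second_moment {X : Type*} [MeasurableSpace X] {L : ℕ} {p : Fin L → X → ℝ} {W : Fin L → X → X}
    (hp : ∀ ℓ, Measurable (p ℓ)) (hW : ∀ ℓ, Measurable (W ℓ)) {x₀ : X} {P : Measure (ℕ → X)}
    (hP : IsMarkovLaw (IFSKernel p W) x₀ P)
    (hs : ∀ x, ∑ ℓ, p ℓ x = 1) (hp0 : ∀ ℓ x, 0 ≤ p ℓ x)
    {g : X → ℝ} (hg : Measurable g) {B : ℝ} (hB : ∀ x, |g x| ≤ B) (n : ℕ) :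
    ∫⁻ ω, ENNReal.ofReal ((∑ j ∈ Finset.range n, (g (ω (j+1)) - TT p W g (ω j)))^2) ∂P
      ≤ n * ENNReal.ofReal (B^2) := by
  have hTm : Measurable (TT p W g) := by
    unfold TT
    exact Finset.measurable_sum _ fun ℓ _ => (hp ℓ).mul (hg.comp (hW ℓ))
  have := hP.1
  induction n with
  | zero => simp
  | succ n ih =>
    set Mf : (Fin (n+1) → X) → ℝ := fun v =>
      ∑ j : Fin n, (g (v j.succ) - TT p W g (v j.castSucc)) with hMf
    have hMfm : Measurable Mf := Finset.measurable_sum _ fun j _ =>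
      (hg.comp (measurable_pi_apply _)).sub (hTm.comp (measurable_pi_apply _))
    have hMe : ∀ ω : ℕ → X, ∑ j ∈ Finset.range n, (g (ω (j+1)) - TT p W g (ω j))
        = Mf (fun i => ω i) := fun ω => by
      rw [hMf, Finset.sum_range]; simp
    set G : (Fin (n+1) → X) → X → ENNReal := fun v y =>
      ENNReal.ofReal ((Mf v + (g y - TT p W g (v (Fin.last n))))^2) with hGd
    have hG : Measurable (Function.uncurry G) := by
      refine Measurable.ennreal_ofReal (Measurable.pow_const ?_ 2)
      exact (hMfm.comp measurable_fst).add ((hg.comp measurable_snd).sub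
        (hTm.comp ((measurable_pi_apply _).comp measurable_fst)))
    have hst := markov_step hp hW hP n hG
    have hl : ∫⁻ ω, ENNReal.ofReal
        ((∑ j ∈ Finset.range (n+1), (g (ω (j+1)) - TT p W g (ω j)))^2) ∂P
        = ∫⁻ ω, G (fun i => ω i) (ω (n+1)) ∂P := by
      refine lintegral_congr fun ω => ?_
      rw [Finset.sum_range_succ, hMe]
      simp [hGd]
    rw [hl, hst]
    calc _ ≤ ∫⁻ ω, (ENNReal.ofReal
          ((∑ j ∈ Finset.range n, (g (ω (j+1)) - TT p W g (ω j)))^2) + ENNReal.ofReal (B^2)) ∂P := by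
          refine lintegral_mono fun ω => ?_
          simp only [hMe]
          rw [← ENNReal.ofReal_add (by positivity) (by positivity)]
          simp only [hGd]
          simp_rw [← ENNReal.ofReal_mul (hp0 _ _)]
          rw [← ENNReal.ofReal_sum_of_nonneg
            (fun ℓ _ => mul_nonneg (hp0 _ _) (sq_nonneg _))]
          apply ENNReal.ofReal_le_ofReal
          simp only [Fin.val_last]
          set M := Mf (fun i => ω i)
          set x := ω n
          set h := TT p W g x with hh
          have e1 : ∑ ℓ, p ℓ x * (M + (g (W ℓ x) - h))^2 =
              (M - h)^2 * ∑ ℓ, p ℓ x + 2 * (M - h) * (∑ ℓ, p ℓ x * g (W ℓ x))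
              + ∑ ℓ, p ℓ x * (g (W ℓ x))^2 := by
            rw [Finset.mul_sum, Finset.mul_sum, ← Finset.sum_add_distrib,
              ← Finset.sum_add_distrib]
            exact Finset.sum_congr rfl fun ℓ _ => by ring
          have e2 : ∑ ℓ, p ℓ x * (g (W ℓ x))^2 ≤ B^2 := by
            calc _ ≤ ∑ ℓ, p ℓ x * B^2 := Finset.sum_le_sum fun ℓ _ =>
                  mul_le_mul_of_nonneg_left (sq_le_sq.2 ((hB _).trans (le_abs_self B))) (hp0 ℓ x)
              _ = B^2 := by rw [← Finset.sum_mul, hs, one_mul]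
          have e3 : ∑ ℓ, p ℓ x * g (W ℓ x) = h := rfl
          rw [e1, hs, e3]
          nlinarith [sq_nonneg h]
      _ = ∫⁻ ω, ENNReal.ofReal
          ((∑ j ∈ Finset.range n, (g (ω (j+1)) - TT p W g (ω j)))^2) ∂P + ENNReal.ofReal (B^2) := by
          rw [lintegral_add_right _ measurable_const]; simp
      _ ≤ _ := by
          push_cast; rw [add_mul, one_mul]; gcongr

lemma interp {M : ℕ → ℝ} {c : ℝ} (hc : ∀ n, |M (n+1) - M n| ≤ c)
    (h : Tendsto (fun k : ℕ => M (k^2) / (k:ℝ)^2) atTop (𝓝 0)) :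
    Tendsto (fun n : ℕ => M n / n) atTop (𝓝 0) := by
  have hc0 : 0 ≤ c := (abs_nonneg _).trans (hc 0)
  have hd : ∀ a b : ℕ, |M (a + b) - M a| ≤ b * c := by
    intro a b
    induction b with
    | zero => simp
    | succ b ih =>
      have := abs_le.1 (hc (a+b))
      have := abs_le.1 ih
      rw [abs_le, ← add_assoc]; push_cast
      constructor <;> linarith
  have hsq : Tendsto (fun n : ℕ => Nat.sqrt n) atTop atTop := by
    refine tendsto_atTop.2 fun b => ?_
    filter_upwards [eventually_ge_atTop (b*b)] with n hn
    exact Nat.le_sqrt.2 hn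
  have h1 : Tendsto (fun k : ℕ => |M (k^2) / (k:ℝ)^2| + 2 * c / (k:ℝ)) atTop (𝓝 0) := by
    have := h.abs.add (tendsto_const_div_atTop_nhds_zero_nat (2 * c))
    simpa using this
  refine squeeze_zero_norm' ?_ (h1.comp hsq)
  filter_upwards [eventually_ge_atTop 1] with n hn
  simp only [Function.comp]
  set k := Nat.sqrt n
  have hk1 : 1 ≤ k := Nat.le_sqrt.2 (by simpa using hn)
  have hk2 : k ^ 2 ≤ n := Nat.sqrt_le' n
  have hk3 : n ≤ k * k + k + k := Nat.sqrt_le_add n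
  clear_value k
  obtain ⟨b, rfl⟩ := Nat.exists_eq_add_of_le hk2
  have hb : b ≤ 2 * k := by nlinarith
  have hkR : (0:ℝ) < k := by exact_mod_cast hk1
  have hkn : (k:ℝ)^2 ≤ ((k^2 + b : ℕ) : ℝ) := by exact_mod_cast hk2
  have hbR : (b:ℝ) ≤ 2 * k := by exact_mod_cast hb
  rw [Real.norm_eq_abs, abs_div, abs_div, abs_of_pos (show (0:ℝ) < (k:ℝ)^2 by positivity),
    Nat.abs_cast]
  have hM : |M (k^2 + b)| ≤ |M (k^2)| + 2 * k * c := by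
    have h1 := hd (k^2) b
    have h2 : |M (k^2+b)| ≤ |M (k^2)| + |M (k^2+b) - M (k^2)| := by
      have := abs_add_le (M (k^2)) (M (k^2+b) - M (k^2))
      simpa using this
    nlinarith
  calc _ ≤ (|M (k^2)| + 2 * k * c) / (k:ℝ)^2 :=
        div_le_div₀ (by positivity) hM (by positivity) hkn
    _ = _ := by field_simp

lemma mart_lln {X : Type*} [MeasurableSpace X] {L : ℕ} {p : Fin L → X → ℝ} {W : Fin L → X → X}
    (hp : ∀ ℓ, Measurable (p ℓ)) (hW : ∀ ℓ, Measurable (W ℓ)) {x₀ : X} {P : Measure (ℕ → X)}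
    (hP : IsMarkovLaw (IFSKernel p W) x₀ P)
    (hs : ∀ x, ∑ ℓ, p ℓ x = 1) (hp0 : ∀ ℓ x, 0 ≤ p ℓ x)
    {g : X → ℝ} (hg : Measurable g) {B : ℝ} (hB : ∀ x, |g x| ≤ B) :
    ∀ᵐ ω ∂P, Tendsto (fun n : ℕ =>
      (∑ j ∈ Finset.range n, (g (ω (j+1)) - TT p W g (ω j))) / n) atTop (𝓝 0) := by
  have hTm : Measurable (TT p W g) := by
    unfold TT
    exact Finset.measurable_sum _ fun ℓ _ => (hp ℓ).mul (hg.comp (hW ℓ))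
  have hTB : ∀ x, |TT p W g x| ≤ B := fun x => abs_le.2
    (TT_range (K := Set.univ) hs hp0 (by simp) (fun x _ => abs_le.1 (hB x)) x trivial)
  set M : ℕ → (ℕ → X) → ℝ := fun n ω => ∑ j ∈ Finset.range n, (g (ω (j+1)) - TT p W g (ω j))
    with hM
  have hMm : ∀ n, Measurable (M n) := fun n => Finset.measurable_sum _ fun j _ =>
      (hg.comp (measurable_pi_apply _)).sub (hTm.comp (measurable_pi_apply _))
  have hmom : ∀ n, ∫⁻ ω, ENNReal.ofReal ((M n ω)^2) ∂P ≤ n * ENNReal.ofReal (B^2) :=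
    second_moment hp hW hP hs hp0 hg hB
  set U : ℕ → (ℕ → X) → ENNReal := fun k ω =>
    ENNReal.ofReal ((M (k^2) ω / (k:ℝ)^2)^2) with hU
  have hUm : ∀ k, Measurable (U k) := fun k =>
    (((hMm _).div_const _).pow_const 2).ennreal_ofReal
  have hUi : ∀ k, ∫⁻ ω, U k ω ∂P ≤ ENNReal.ofReal (B^2 * (1 / (k:ℝ)^2)) := by
    intro k
    rcases Nat.eq_zero_or_pos k with rfl | hk
    · simp [hU]
    have hkR : (0:ℝ) < k := by exact_mod_cast hk
    have : ∀ ω, U k ω = ENNReal.ofReal (1 / ((k:ℝ)^2)^2) * ENNReal.ofReal ((M (k^2) ω)^2) := by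
      intro ω
      rw [← ENNReal.ofReal_mul (by positivity), hU]
      field_simp
    simp_rw [this]
    rw [lintegral_const_mul _ ((hMm _).pow_const 2).ennreal_ofReal]
    calc _ ≤ ENNReal.ofReal (1 / ((k:ℝ)^2)^2) * (((k^2 : ℕ) : ENNReal) * ENNReal.ofReal (B^2)) := by
          gcongr; exact hmom _
      _ = _ := by
          rw [← ENNReal.ofReal_natCast, ← ENNReal.ofReal_mul (by positivity),
            ← ENNReal.ofReal_mul (by positivity)]
          congr 1; push_cast; field_simp
  have hfin : ∫⁻ ω, ∑' k, U k ω ∂P ≠ ⊤ := by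
    rw [lintegral_tsum fun k => (hUm k).aemeasurable]
    have hsm : Summable (fun k : ℕ => B^2 * (1 / (k:ℝ)^2)) :=
      (Real.summable_one_div_nat_pow.2 one_lt_two).mul_left _
    refine ne_top_of_le_ne_top ?_ (ENNReal.tsum_le_tsum hUi)
    rw [← ENNReal.ofReal_tsum_of_nonneg (fun k => by positivity) hsm]
    exact ENNReal.ofReal_ne_top
  have hae := ae_lt_top' (AEMeasurable.tsum fun k => (hUm k).aemeasurable) hfin
  filter_upwards [hae] with ω hω
  apply interp (M := fun n => M n ω) (c := 2 * B)
  · intro n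
    simp only [hM, Finset.sum_range_succ]
    have h1 := abs_le.1 (hB (ω (n+1)))
    have h2 := abs_le.1 (hTB (ω n))
    rw [abs_le]; constructor <;> linarith
  · have ht := ENNReal.tendsto_atTop_zero_of_tsum_ne_top hω.ne
    have ht2 : Tendsto (fun k : ℕ => (M (k^2) ω / (k:ℝ)^2)^2) atTop (𝓝 0) := by
      have := (ENNReal.tendsto_toReal ENNReal.zero_ne_top).comp ht
      simp only [ENNReal.toReal_zero] at this
      refine this.congr fun k => ?_
      simp only [Function.comp, hU]
      exact ENNReal.toReal_ofReal (sq_nonneg _)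
    have := ht2.sqrt
    simp only [Real.sqrt_zero, Real.sqrt_sq_eq_abs] at this
    exact (tendsto_zero_iff_abs_tendsto_zero _).2 this

lemma integral_TT {X : Type*} [MeasurableSpace X] {L : ℕ} {p : Fin L → X → ℝ} {W : Fin L → X → X}
    (hp : ∀ ℓ, Measurable (p ℓ)) (hW : ∀ ℓ, Measurable (W ℓ))
    (hs : ∀ x, ∑ ℓ, p ℓ x = 1) (hp0 : ∀ ℓ x, 0 ≤ p ℓ x) {μ : Measure X} [IsProbabilityMeasure μ]
    (hinv : Invariant (IFSKernel p W) μ)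
    {g : X → ℝ} (hg : Measurable g) {B : ℝ} (hB : ∀ x, |g x| ≤ B) :
    ∫ x, TT p W g x ∂μ = ∫ x, g x ∂μ := by
  have hTm : Measurable (TT p W g) := by
    unfold TT
    exact Finset.measurable_sum _ fun ℓ _ => (hp ℓ).mul (hg.comp (hW ℓ))
  have hTB : ∀ x, |TT p W g x| ≤ B := fun x => abs_le.2
    (TT_range (K := Set.univ) hs hp0 (by simp) (fun x _ => abs_le.1 (hB x)) x trivial)
  have aux : ∀ u : X → ℝ, Measurable u → (∀ x, |u x| ≤ B) →
      ∫ x, u x ∂μ = (∫⁻ x, ENNReal.ofReal (u x + B) ∂μ).toReal - B := by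
    intro u hu hb
    have hi : Integrable u μ := Integrable.of_bound hu.aestronglyMeasurable B
      (ae_of_all _ hb)
    rw [← integral_eq_lintegral_of_nonneg_ae
      (ae_of_all _ fun x => by have := (abs_le.1 (hb x)).1; simp; linarith)
      (hu.add_const B).aestronglyMeasurable, integral_add hi (integrable_const _)]
    simp
  rw [aux _ hTm hTB, aux _ hg hB]
  congr 2
  have hm : Measurable (fun x => ENNReal.ofReal (g x + B)) := (hg.add_const B).ennreal_ofReal
  conv_rhs => rw [← show μ.bind (IFSKernel p W) = μ from hinv]
  rw [Measure.lintegral_bind (IFS_meas hp hW).aemeasurable hm.aemeasurable]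
  refine lintegral_congr fun x => ?_
  rw [IFSKernel, lintegral_sum_dirac _ _ hm]
  simp_rw [← ENNReal.ofReal_mul (hp0 _ _)]
  rw [← ENNReal.ofReal_sum_of_nonneg]
  · congr 1
    simp_rw [mul_add]
    rw [Finset.sum_add_distrib, ← Finset.sum_mul, hs, one_mul]; rfl
  · intro ℓ _
    have := (abs_le.1 (hB (W ℓ x))).1
    exact mul_nonneg (hp0 _ _) (by linarith)

lemma avg_shift {X : Type*} {g h : X → ℝ} {B : ℝ} (hB : ∀ x, |g x| ≤ B) (ω : ℕ → X)
    (hM : Tendsto (fun n : ℕ =>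
      (∑ j ∈ Finset.range n, (g (ω (j+1)) - h (ω j))) / n) atTop (𝓝 0)) :
    Tendsto (fun n : ℕ => (∑ j ∈ Finset.range n, g (ω j)) / n
      - (∑ j ∈ Finset.range n, h (ω j)) / n) atTop (𝓝 0) := by
  have h1 : Tendsto (fun n : ℕ => (g (ω n) - g (ω 0)) / (n:ℝ)) atTop (𝓝 0) := by
    refine squeeze_zero_norm (fun n => ?_) (tendsto_const_div_atTop_nhds_zero_nat (2 * B))
    rw [norm_div, Real.norm_natCast]
    gcongr
    have h1 := abs_le.1 (hB (ω n))
    have h2 := abs_le.1 (hB (ω 0))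
    rw [Real.norm_eq_abs, abs_le]; constructor <;> linarith
  have := hM.sub h1
  rw [sub_zero] at this
  refine this.congr fun n => ?_
  have e := Finset.sum_range_succ (fun j => g (ω j)) n
  rw [Finset.sum_range_succ'] at e
  rw [Finset.sum_sub_distrib, ← sub_div, ← sub_div]
  congr 1; linarith

/-- Unique ergodicity of the affine closed-loop system: for a Schur matrix `𝒜`, affine maps
`W ℓ ξ = 𝒜 ξ + β ℓ` chosen with Dini continuous probabilities bounded below by `δ > 0`, with
invariant probability measure `μstar` for the associated Markov kernel, the time averages of
any bounded continuous observable along the Markov chain started at any `x₀` converge almost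
surely to the space average `∫ f dμstar`; in particular the limit does not depend on `x₀`. -/
theorem affine_IFS_unique_ergodicity {d L : ℕ}
    (𝒜 : Matrix (Fin d) (Fin d) ℝ) (hA : IsSchur 𝒜)
    (β : Fin L → EuclideanSpace ℝ (Fin d))
    (W : Fin L → EuclideanSpace ℝ (Fin d) → EuclideanSpace ℝ (Fin d))
    (hW : ∀ ℓ ξ, W ℓ ξ = Matrix.toEuclideanLin 𝒜 ξ + β ℓ)
    (p : Fin L → EuclideanSpace ℝ (Fin d) → ℝ)
    (hp01 : ∀ ℓ x, p ℓ x ∈ Set.Icc (0 : ℝ) 1)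
    (hpDini : ∀ ℓ, DiniContinuous (p ℓ))
    (hpsum : ∀ x, ∑ ℓ, p ℓ x = 1)
    (δ : ℝ) (hδ : 0 < δ) (hplb : ∀ ℓ x, δ ≤ p ℓ x)
    (μstar : Measure (EuclideanSpace ℝ (Fin d)))
    (hμstar : IsProbabilityMeasure μstar)
    (hinv : Invariant (IFSKernel p W) μstar)
    (x₀ : EuclideanSpace ℝ (Fin d))
    (P : Measure (ℕ → EuclideanSpace ℝ (Fin d)))
    (hP : IsMarkovLaw (IFSKernel p W) x₀ P)
    (f : BoundedContinuousFunction (EuclideanSpace ℝ (Fin d)) ℝ) :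
    ∀ᵐ ω ∂P, Tendsto
      (fun k : ℕ => ((k : ℝ) + 1)⁻¹ * ∑ j ∈ Finset.range (k + 1), f (ω j))
      atTop (𝓝 (∫ x, f x ∂μstar)) := by
  have hδ1 : 0 ≤ 1 - δ := by
    rcases Nat.eq_zero_or_pos L with h | h
    · subst h; simp at hpsum
    · linarith [hplb ⟨0, h⟩ 0, (hp01 ⟨0, h⟩ 0).2]
  have hL : 0 < L := by
    rcases Nat.eq_zero_or_pos L with h | h
    · subst h; simp at hpsum
    · exact h
  have hp0 : ∀ ℓ x, 0 ≤ p ℓ x := fun ℓ x => (hp01 ℓ x).1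
  choose φ hφm hφ0 hφi hφ using hpDini
  have hφnn : ∀ ℓ t, 0 ≤ t → 0 ≤ φ ℓ t := fun ℓ t ht => by
    rw [← hφ0 ℓ]; exact hφm ℓ (by simp) ht ht
  have hpc : ∀ ℓ, Continuous (p ℓ) := fun ℓ => dini_continuous (hφm ℓ) (hφ0 ℓ) (hφi ℓ) (hφ ℓ)
  obtain ⟨r, C, hr0, hr1, hC0, hC⟩ := pow_bound_of_schur 𝒜 hA
  set A := Matrix.toEuclideanLin 𝒜 with hAdef
  have hAc : ∀ n, Continuous ⇑(A ^ n) := fun n => LinearMap.continuous_of_finiteDimensional _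
  have hWc : ∀ ℓ, Continuous (W ℓ) := fun ℓ => by
    have : W ℓ = fun ξ => A ξ + β ℓ := funext (hW ℓ)
    rw [this]
    have := hAc 1
    rw [pow_one] at this
    exact this.add continuous_const
  have hpm : ∀ ℓ, Measurable (p ℓ) := fun ℓ => (hpc ℓ).measurable
  have hWm : ∀ ℓ, Measurable (W ℓ) := fun ℓ => (hWc ℓ).measurable
  set B := ‖f‖ with hBdef
  have hfB : ∀ x, |f x| ≤ B := fun x => f.norm_coe_le_norm x
  set g : ℕ → EuclideanSpace ℝ (Fin d) → ℝ := fun k => (TT p W)^[k] f with hg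
  have hgc : ∀ k, Continuous (g k) := fun k => TT_iter_cont hpc hWc f.continuous k
  have hgB : ∀ k x, |g k x| ≤ B := fun k x => abs_le.2
    (TT_iter_range (K := Set.univ) hpsum hp0 (by simp) (fun x _ => abs_le.1 (hfB x)) k x trivial)
  have hgs : ∀ k, g (k+1) = TT p W (g k) := fun k => Function.iterate_succ_apply' _ _ _
  set K : ℝ → Set (EuclideanSpace ℝ (Fin d)) := fun R => {x | ∀ n : ℕ, ‖(A ^ n) x‖ ≤ r ^ n * R}
    with hKdef
  have hKcl : ∀ R, IsClosed (K R) := fun R => by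
    have : K R = ⋂ n : ℕ, {x | ‖(A ^ n) x‖ ≤ r ^ n * R} := by ext; simp [hKdef]
    rw [this]
    exact isClosed_iInter fun n => isClosed_le (hAc n).norm continuous_const
  have hKco : ∀ R, IsCompact (K R) := fun R =>
    (isCompact_closedBall 0 R).of_isClosed_subset (hKcl R) fun x hx => by
      have := hx 0
      simpa using this
  set R0 : ℝ := (∑ ℓ, C * ‖β ℓ‖) / (1 - r) with hR0
  have h1r : 0 < 1 - r := by linarith
  have hKinv : ∀ R, R0 ≤ R → ∀ x ∈ K R, ∀ ℓ, W ℓ x ∈ K R := by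
    intro R hR x hx ℓ n
    have hb : C * ‖β ℓ‖ ≤ (1 - r) * R := by
      have h1 : C * ‖β ℓ‖ ≤ ∑ ℓ, C * ‖β ℓ‖ :=
        Finset.single_le_sum (f := fun ℓ => C * ‖β ℓ‖) (fun _ _ => by positivity)
          (Finset.mem_univ ℓ)
      have h2 : (1 - r) * R0 = ∑ ℓ, C * ‖β ℓ‖ := by rw [hR0]; field_simp
      nlinarith
    have e : (A ^ n) (W ℓ x) = (A ^ (n+1)) x + (A ^ n) (β ℓ) := by
      rw [hW, map_add, pow_succ]; rfl
    rw [e]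
    refine (norm_add_le _ _).trans ((add_le_add (hx (n+1)) (hC n (β ℓ))).trans ?_)
    have hrn : 0 < r ^ n := pow_pos hr0 n
    rw [pow_succ]
    nlinarith
  have hKmem : ∀ R x, C * ‖x‖ ≤ R → x ∈ K R := by
    intro R x hx n
    refine (hC n x).trans ?_
    have hrn : 0 < r ^ n := pow_pos hr0 n
    nlinarith
  have hosc : ∀ R, R0 ≤ R → 0 ≤ R → ∀ η > 0, ∃ N, ∀ n ≥ N, ∀ x ∈ K R, ∀ y ∈ K R,
      |g n x - g n y| ≤ η := by
    intro R hR hRnn η hη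
    refine osc_tendsto (K := K R) (B := B) (δ := δ) (f := f)
      (θ := fun i => min (1 - δ) (∑ ℓ, φ ℓ (2 * R * r ^ i)))
      (S := fun i x y => ∀ j, ‖(A ^ j) (x - y)‖ ≤ 2 * R * r ^ (i + j)) hδ hpsum hp0 (hKinv R hR)
      (fun x _ => hfB x) ?_ ?_ ?_ ?_ ?_ ?_ ?_ η hη
    · intro x hx y hy j
      rw [map_sub, zero_add]
      refine (norm_sub_le _ _).trans ?_
      linarith [hx j, hy j]
    · intro i x y h ℓ j
      have e : (A ^ j) (W ℓ x - W ℓ y) = (A ^ (j+1)) (x - y) := by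
        rw [hW, hW, add_sub_add_right_eq_sub, ← map_sub, pow_succ]; rfl
      rw [e, show i + 1 + j = i + (j + 1) by ring]
      exact h (j+1)
    · intro i x y h
      refine le_min ?_ ?_
      · have h1 : min (p ⟨0, hL⟩ x) (p ⟨0, hL⟩ y) ≤ ∑ ℓ, min (p ℓ x) (p ℓ y) :=
          Finset.single_le_sum (f := fun ℓ => min (p ℓ x) (p ℓ y))
            (fun ℓ _ => le_min (hp0 ℓ x) (hp0 ℓ y)) (Finset.mem_univ _)
        have h2 := le_min (hplb ⟨0, hL⟩ x) (hplb ⟨0, hL⟩ y)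
        linarith
      · rw [← hpsum x, ← Finset.sum_sub_distrib]
        refine Finset.sum_le_sum fun ℓ _ => ?_
        have h1 : p ℓ x - min (p ℓ x) (p ℓ y) ≤ |p ℓ x - p ℓ y| := by
          rcases le_total (p ℓ x) (p ℓ y) with h | h
          · rw [min_eq_left h]; simp
          · rw [min_eq_right h]; exact le_abs_self _
        refine h1.trans ((hφ ℓ x y).trans (hφm ℓ dist_nonneg ?_ ?_))
        · simp only [Set.mem_Ici]; positivity
        · have := h 0
          rw [dist_eq_norm]
          simpa using this
    · intro i
      exact le_min hδ1 (Finset.sum_nonneg fun ℓ _ => hφnn ℓ _ (by positivity))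
    · intro i; exact min_le_left _ _
    · refine Summable.of_nonneg_of_le
        (fun i => le_min hδ1 (Finset.sum_nonneg fun ℓ _ => hφnn ℓ _ (by positivity)))
        (fun i => min_le_right _ _) ?_
      exact summable_sum fun ℓ _ => dini_summable' (hφm ℓ) (hφ0 ℓ) (hφi ℓ) hr0 hr1 (by positivity)
    · intro m ε hε
      have huc := (hKco R).uniformContinuousOn_of_continuous (hgc m).continuousOn
      rw [Metric.uniformContinuousOn_iff] at huc
      obtain ⟨ρ, hρ, hh⟩ := huc ε hε
      have hlim : Tendsto (fun k : ℕ => 2 * R * r ^ k) atTop (𝓝 (2 * R * 0)) :=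
        (tendsto_pow_atTop_nhds_zero_of_lt_one hr0.le hr1).const_mul _
      rw [mul_zero] at hlim
      obtain ⟨n, hn⟩ := (hlim.eventually (gt_mem_nhds hρ)).exists
      refine ⟨n, fun x hx y hy h => ?_⟩
      have h0 := h 0
      simp only [pow_zero, add_zero] at h0
      have h1 := hh x hx y hy (by rw [dist_eq_norm]; exact lt_of_le_of_lt h0 hn)
      rw [Real.dist_eq] at h1
      exact h1.le
  have hint : ∀ k, ∫ x, g k x ∂μstar = ∫ x, f x ∂μstar := by
    intro k
    induction k with
    | zero => rfl
    | succ k ih =>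
      rw [hgs, integral_TT hpm hWm hpsum hp0 hinv (hgc k).measurable (hgB k), ih]
  have hpt : Tendsto (fun k => g k x₀) atTop (𝓝 (∫ x, f x ∂μstar)) := by
    have hd : Tendsto (fun k => ∫ x, (g k x₀ - g k x) ∂μstar) atTop
        (𝓝 (∫ _, (0:ℝ) ∂μstar)) := by
      refine tendsto_integral_of_dominated_convergence (fun _ => 2 * B) ?_
        (integrable_const _) ?_ ?_
      · intro k
        exact (continuous_const.sub (hgc k)).measurable.aestronglyMeasurable
      · intro k
        refine ae_of_all _ fun x => ?_
        have h1 := abs_le.1 (hgB k x)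
        have h2 := abs_le.1 (hgB k x₀)
        rw [Real.norm_eq_abs, abs_le]; constructor <;> linarith
      · refine ae_of_all _ fun x => ?_
        rw [Metric.tendsto_atTop]
        intro ε hε
        obtain ⟨N, hN⟩ := hosc (max (max R0 0) (max (C * ‖x‖) (C * ‖x₀‖)))
          (le_trans (le_max_left _ _) (le_max_left _ _))
          (le_trans (le_max_right _ _) (le_max_left _ _)) (ε/2) (half_pos hε)
        refine ⟨N, fun n hn => ?_⟩
        have := hN n hn x₀ (hKmem _ _ (le_trans (le_max_right _ _) (le_max_right _ _))) x
          (hKmem _ _ (le_trans (le_max_left _ _) (le_max_right _ _)))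
        rw [Real.dist_eq, sub_zero]
        linarith
    have he : ∀ k, ∫ x, (g k x₀ - g k x) ∂μstar = g k x₀ - ∫ x, f x ∂μstar := by
      intro k
      rw [integral_sub (integrable_const _)
        (Integrable.of_bound (hgc k).measurable.aestronglyMeasurable B (ae_of_all _ (hgB k))), hint]
      simp
    simp_rw [he] at hd
    simp only [integral_zero] at hd
    simpa using hd.add_const (∫ x, f x ∂μstar)
  set R := max (max R0 0) (C * ‖x₀‖) with hRdef
  have hR1 : R0 ≤ R := le_trans (le_max_left _ _) (le_max_left _ _)
  have hR2 : 0 ≤ R := le_trans (le_max_right _ _) (le_max_left _ _)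
  have hxK : x₀ ∈ K R := hKmem _ _ (le_max_right _ _)
  have hmart : ∀ᵐ ω ∂P, ∀ k, Tendsto (fun n : ℕ =>
      (∑ j ∈ Finset.range n, (g k (ω (j+1)) - g (k+1) (ω j))) / n) atTop (𝓝 0) := by
    rw [ae_all_iff]
    intro k
    rw [hgs]
    exact mart_lln hpm hWm hP hpsum hp0 (hgc k).measurable (hgB k)
  filter_upwards [hmart, markov_mem hpm hWm hP (hKcl R).measurableSet (hKinv R hR1) hxK]
    with ω hω hωK
  set I := ∫ x, f x ∂μstar with hI
  have havg : ∀ k, Tendsto (fun n : ℕ => (∑ j ∈ Finset.range n, f (ω j)) / n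
      - (∑ j ∈ Finset.range n, g k (ω j)) / n) atTop (𝓝 0) := by
    intro k
    induction k with
    | zero =>
      refine tendsto_const_nhds.congr fun n => ?_
      simp [hg]
    | succ k ih =>
      have := ih.add (avg_shift (hgB k) ω (hω k))
      simpa using this
  have hmain : Tendsto (fun n : ℕ => (∑ j ∈ Finset.range n, f (ω j)) / (n:ℝ)) atTop (𝓝 I) := by
    rw [Metric.tendsto_atTop]
    intro ε hε
    obtain ⟨N1, hN1⟩ := hosc R hR1 hR2 (ε/4) (by positivity)
    obtain ⟨N2, hN2⟩ := (Metric.tendsto_atTop.1 hpt) (ε/4) (by positivity)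
    set k := max N1 N2
    obtain ⟨N3, hN3⟩ := (Metric.tendsto_atTop.1 (havg k)) (ε/4) (by positivity)
    refine ⟨max N3 1, fun n hn => ?_⟩
    have h3 := hN3 n (le_trans (le_max_left _ _) hn)
    have hn1 : 1 ≤ n := le_trans (le_max_right _ _) hn
    have hnR : (0:ℝ) < n := by exact_mod_cast hn1
    have hk : ∀ j, |g k (ω j) - I| ≤ ε/2 := fun j => by
      have h1 := abs_le.1 (hN1 k (le_max_left _ _) _ (hωK j) _ hxK)
      have h2 := hN2 k (le_max_right _ _)
      rw [Real.dist_eq] at h2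
      have h2 := abs_lt.1 h2
      rw [abs_le]; constructor <;> linarith
    have hs : |(∑ j ∈ Finset.range n, g k (ω j)) / n - I| ≤ ε/2 := by
      have e : (∑ j ∈ Finset.range n, g k (ω j)) / n - I
          = (∑ j ∈ Finset.range n, (g k (ω j) - I)) / n := by
        rw [Finset.sum_sub_distrib]; simp; field_simp
      rw [e, abs_div, abs_of_pos hnR, div_le_iff₀ hnR]
      refine (Finset.abs_sum_le_sum_abs _ _).trans
        ((Finset.sum_le_card_nsmul _ _ _ fun j _ => hk j).trans (le_of_eq ?_))
      simp; ring
    rw [Real.dist_eq] at h3 ⊢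
    have h3 := abs_lt.1 h3
    have hs := abs_le.1 hs
    rw [abs_lt]; constructor <;> linarith
  have := hmain.comp (tendsto_add_atTop_nat 1)
  refine this.congr fun k => ?_
  simp only [Function.comp]
  push_cast
  rw [div_eq_inv_mul]
end
end

section
/- (Ergodicity in Theorem 2: time averages for the contractive nonlinear closed loop.) Let X = ℝ^{n_S} × ℝ^{n_C}, and for ℓ = 1, …, L let W_ℓ(x, z) = (w_ℓ(x), A z + g_ℓ(x)), where each w_ℓ : ℝ^{n_S} → ℝ^{n_S} is globally Lipschitz with Lipschitz constant l_ℓ < 1, each g_ℓ : ℝ^{n_S} → ℝ^{n_C} is globally Lipschitz, and A is an n_C×n_C real Schur matrix. Let p₁, …, p_L : X → [0,1] be Dini continuous probability functions with Σ_ℓ p_ℓ(ξ) = 1 and p_ℓ(ξ) ≥ δ for some δ > 0 and all ξ, let κ(ξ) = Σ_ℓ p_ℓ(ξ)·δ_{W_ℓ(ξ)} be the associated Markov kernel, and let μ* be its (unique) invariant probability measure. Then for every initial point ξ₀ ∈ X and every bounded continuous f : X → ℝ, almost surely with respect to the law P_{ξ₀} of the Markov chain started at ξ₀ with transition kernel κ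 (given by the Ionescu–Tulcea construction on the path space X^ℕ), the time averages (1/(k+1)) Σ_{j=0}^{k} f(X(j)) converge as k → ∞ to ∫ f dμ*, and the limit does not depend on ξ₀. -/
open MeasureTheory Filter Topology

noncomputable section

/-- transfer operator -/
def PU {X : Type*} {L : ℕ} (p : Fin L → X → ℝ) (W : Fin L → X → X) (f : X → ℝ) : X → ℝ :=
  fun x => ∑ ℓ, p ℓ x * f (W ℓ x)

lemma PU_bound {X : Type*} {L : ℕ} {p : Fin L → X → ℝ} {W : Fin L → X → X}
    (hp0 : ∀ ℓ x, 0 ≤ p ℓ x) (hps : ∀ x, ∑ ℓ, p ℓ x = 1) {f : X → ℝ} {M : ℝ}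
    (hf : ∀ x, |f x| ≤ M) (x : X) : |PU p W f x| ≤ M := by
  unfold PU
  calc |∑ ℓ, p ℓ x * f (W ℓ x)| ≤ ∑ ℓ, |p ℓ x * f (W ℓ x)| := Finset.abs_sum_le_sum_abs _ _
    _ ≤ ∑ ℓ, p ℓ x * M := by
        apply Finset.sum_le_sum
        intro ℓ _
        rw [abs_mul, abs_of_nonneg (hp0 ℓ x)]
        exact mul_le_mul_of_nonneg_left (hf _) (hp0 ℓ x)
    _ = M := by rw [← Finset.sum_mul, hps, one_mul]

lemma PU_iter_bound {X : Type*} {L : ℕ} {p : Fin L → X → ℝ} {W : Fin L → X → X}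
    (hp0 : ∀ ℓ x, 0 ≤ p ℓ x) (hps : ∀ x, ∑ ℓ, p ℓ x = 1) {f : X → ℝ} {M : ℝ}
    (hf : ∀ x, |f x| ≤ M) (n : ℕ) (x : X) : |(PU p W)^[n] f x| ≤ M := by
  induction n generalizing x with
  | zero => exact hf x
  | succ n ih =>
    rw [Function.iterate_succ_apply']
    exact PU_bound hp0 hps ih x

lemma PU_cont {X : Type*} [TopologicalSpace X] {L : ℕ} {p : Fin L → X → ℝ} {W : Fin L → X → X}
    (hp : ∀ ℓ, Continuous (p ℓ)) (hW : ∀ ℓ, Continuous (W ℓ)) {f : X → ℝ} (hf : Continuous f)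
    (n : ℕ) : Continuous ((PU p W)^[n] f) := by
  induction n with
  | zero => exact hf
  | succ n ih =>
    rw [Function.iterate_succ_apply']
    unfold PU
    exact continuous_finsetSum _ fun ℓ _ => (hp ℓ).mul (ih.comp (hW ℓ))

lemma PU_step {X : Type*} {L : ℕ} {p : Fin L → X → ℝ} {W : Fin L → X → X}
    (hps : ∀ x, ∑ ℓ, p ℓ x = 1)
    {δ : ℝ} (hδ : 0 < δ) (hplb : ∀ ℓ x, δ ≤ p ℓ x) {K : Set X}
    (hK : ∀ ℓ, ∀ x ∈ K, W ℓ x ∈ K) {g : X → ℝ} {O E ε : ℝ} (hEO : E ≤ O)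
    (hO : ∀ x ∈ K, ∀ y ∈ K, |g x - g y| ≤ O)
    {x y : X} (hx : x ∈ K) (hy : y ∈ K) (hE : ∀ ℓ, |g (W ℓ x) - g (W ℓ y)| ≤ E)
    (hε : min (∑ ℓ, |p ℓ x - p ℓ y|) (1 - δ) ≤ ε) :
    |PU p W g x - PU p W g y| ≤ O - (1 - ε) * (O - E) := by
  set m : Fin L → ℝ := fun ℓ => min (p ℓ x) (p ℓ y) with hm
  have hm0 : ∀ ℓ, δ ≤ m ℓ := fun ℓ => le_min (hplb ℓ x) (hplb ℓ y)
  have hLpos : 0 < L := by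
    rcases Nat.eq_zero_or_pos L with h | h
    · subst h; simpa using hps x
    · exact h
  set e := 1 - ∑ ℓ, m ℓ with he
  have hex : ∑ ℓ, (p ℓ x - m ℓ) = e := by rw [Finset.sum_sub_distrib, hps]
  have hey : ∑ ℓ, (p ℓ y - m ℓ) = e := by rw [Finset.sum_sub_distrib, hps]
  have he1 : e ≤ ∑ ℓ, |p ℓ x - p ℓ y| := by
    rw [← hex]
    apply Finset.sum_le_sum
    intro ℓ _
    simp only [hm]
    rcases le_total (p ℓ x) (p ℓ y) with h | h
    · rw [min_eq_left h]; simp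
    · rw [min_eq_right h]; exact le_abs_self _
  have he2 : e ≤ 1 - δ := by
    have : m ⟨0, hLpos⟩ ≤ ∑ ℓ, m ℓ :=
      Finset.single_le_sum (fun ℓ _ => hδ.le.trans (hm0 ℓ)) (Finset.mem_univ _)
    have := hm0 ⟨0, hLpos⟩
    linarith
  have heε : e ≤ ε := (le_min he1 he2).trans hε
  have he0 : 0 ≤ e := by
    rw [← hex]; exact Finset.sum_nonneg fun ℓ _ => sub_nonneg.2 (min_le_left _ _)
  -- bound on values
  have hKey : ∀ s : ℝ, (∀ a ∈ K, ∀ b ∈ K, s * (g a - g b) ≤ O) → (∀ ℓ, s * (g (W ℓ x) - g (W ℓ y)) ≤ E) →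
      s * (PU p W g x - PU p W g y) ≤ (1 - e) * E + e * O := by
    intro s h1 h2
    -- excess part
    have hex2 : s * (∑ ℓ, (p ℓ x - m ℓ) * g (W ℓ x) - ∑ ℓ, (p ℓ y - m ℓ) * g (W ℓ y)) ≤ e * O := by
      rcases he0.eq_or_lt with h0 | h0
      · have a1 : ∀ ℓ, p ℓ x - m ℓ = 0 := by
          intro ℓ
          have := (Finset.sum_eq_zero_iff_of_nonneg (s := Finset.univ) (f := fun ℓ => p ℓ x - m ℓ)
            (fun ℓ _ => sub_nonneg.2 (min_le_left _ _))).1 (by rw [hex, ← h0])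
          exact this ℓ (Finset.mem_univ _)
        have a2 : ∀ ℓ, p ℓ y - m ℓ = 0 := by
          intro ℓ
          have := (Finset.sum_eq_zero_iff_of_nonneg (s := Finset.univ) (f := fun ℓ => p ℓ y - m ℓ)
            (fun ℓ _ => sub_nonneg.2 (min_le_right _ _))).1 (by rw [hey, ← h0])
          exact this ℓ (Finset.mem_univ _)
        simp [a1, a2, ← h0]
      · have : e * (s * (∑ ℓ, (p ℓ x - m ℓ) * g (W ℓ x) - ∑ ℓ, (p ℓ y - m ℓ) * g (W ℓ y)))
            = ∑ i, ∑ j, (p i x - m i) * (p j y - m j) * (s * (g (W i x) - g (W j y))) := by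
          have b1 : ∑ i, ∑ j, (p i x - m i) * (p j y - m j) * (s * (g (W i x) - g (W j y)))
            = s * ((∑ j, (p j y - m j)) * (∑ i, (p i x - m i) * g (W i x))
              - (∑ i, (p i x - m i)) * (∑ j, (p j y - m j) * g (W j y))) := by
            rw [Finset.sum_mul_sum, Finset.sum_mul_sum, Finset.sum_comm, mul_sub, Finset.mul_sum, Finset.mul_sum]
            conv_rhs => rw [Finset.sum_congr rfl fun i _ => Finset.mul_sum _ _ _]
            rw [Finset.sum_comm (f := fun i j => (p j x - m j) * (p i y - m i) * (s * (g (W j x) - g (W i y))))]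
            conv_rhs => rw [Finset.sum_comm]
            rw [← Finset.sum_sub_distrib]
            apply Finset.sum_congr rfl; intro i _
            rw [Finset.mul_sum, ← Finset.sum_sub_distrib]
            apply Finset.sum_congr rfl; intro j _
            ring
          rw [b1, hex, hey]; ring
        have h3 : e * (s * (∑ ℓ, (p ℓ x - m ℓ) * g (W ℓ x) - ∑ ℓ, (p ℓ y - m ℓ) * g (W ℓ y))) ≤ e * (e * O) := by
          rw [this]
          calc _ ≤ ∑ i, ∑ j, (p i x - m i) * (p j y - m j) * O := by
                apply Finset.sum_le_sum; intro i _
                apply Finset.sum_le_sum; intro j _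
                exact mul_le_mul_of_nonneg_left (h1 _ (hK i x hx) _ (hK j y hy))
                  (mul_nonneg (sub_nonneg.2 (min_le_left _ _)) (sub_nonneg.2 (min_le_right _ _)))
            _ = e * (e * O) := by
                conv_rhs => rw [← mul_assoc]; lhs; rw [← hex]; rhs; rw [hex, ← hey]
                rw [Finset.sum_mul_sum, Finset.sum_mul]
                simp_rw [Finset.sum_mul]
        exact le_of_mul_le_mul_left h3 h0
    have hmm : s * ∑ ℓ, m ℓ * (g (W ℓ x) - g (W ℓ y)) ≤ (1 - e) * E := by
      rw [show 1 - e = ∑ ℓ, m ℓ by rw [he]; ring, Finset.mul_sum, Finset.sum_mul]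
      apply Finset.sum_le_sum
      intro ℓ _
      have := mul_le_mul_of_nonneg_left (h2 ℓ) (hδ.le.trans (hm0 ℓ))
      linarith
    have : PU p W g x - PU p W g y = ∑ ℓ, m ℓ * (g (W ℓ x) - g (W ℓ y)) +
      (∑ ℓ, (p ℓ x - m ℓ) * g (W ℓ x) - ∑ ℓ, (p ℓ y - m ℓ) * g (W ℓ y)) := by
      unfold PU
      rw [← Finset.sum_sub_distrib, ← Finset.sum_sub_distrib, ← Finset.sum_add_distrib]
      apply Finset.sum_congr rfl; intro i _; ring
    rw [this, mul_add]
    linarith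
  have k1 := hKey 1 (fun a ha b hb => by rw [one_mul]; exact (abs_le.1 (hO a ha b hb)).2)
    (fun ℓ => by rw [one_mul]; exact (abs_le.1 (hE ℓ)).2)
  have k2 := hKey (-1) (fun a ha b hb => by linarith [(abs_le.1 (hO a ha b hb)).1])
    (fun ℓ => by linarith [(abs_le.1 (hE ℓ)).1])
  have k3 : (1 - e) * E + e * O ≤ O - (1 - ε) * (O - E) := by nlinarith
  rw [abs_le]; constructor <;> linarith

lemma PU_osc {X : Type*} {L : ℕ} {p : Fin L → X → ℝ} {W : Fin L → X → X}
    (hps : ∀ x, ∑ ℓ, p ℓ x = 1)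
    {δ : ℝ} (hδ : 0 < δ) (hplb : ∀ ℓ x, δ ≤ p ℓ x) {K : Set X}
    (hK : ∀ ℓ, ∀ x ∈ K, W ℓ x ∈ K) {g : X → ℝ} {O : ℝ}
    (hO : ∀ x ∈ K, ∀ y ∈ K, |g x - g y| ≤ O) (n : ℕ) :
    ∀ x ∈ K, ∀ y ∈ K, |(PU p W)^[n] g x - (PU p W)^[n] g y| ≤ O := by
  induction n with
  | zero => exact hO
  | succ n ih =>
    intro x hx y hy
    rw [Function.iterate_succ_apply']
    have := PU_step hps hδ hplb hK le_rfl ih hx hy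
      (fun ℓ => ih _ (hK ℓ x hx) _ (hK ℓ y hy)) le_rfl
    simpa using this

lemma PU_multi {X : Type*} {L : ℕ} {p : Fin L → X → ℝ} {W : Fin L → X → X}
    (hps : ∀ x, ∑ ℓ, p ℓ x = 1)
    {δ : ℝ} (hδ : 0 < δ) (hδ1 : δ ≤ 1) (hplb : ∀ ℓ x, δ ≤ p ℓ x) {K : Set X}
    (hK : ∀ ℓ, ∀ x ∈ K, W ℓ x ∈ K) {d : X → X → ℝ} {r : ℝ} (hr : 0 < r)
    (hd : ∀ ℓ x y, d (W ℓ x) (W ℓ y) ≤ r * d x y) {Φ : ℝ → ℝ}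
    (hΦ : ∀ x y t, d x y ≤ t → ∑ ℓ, |p ℓ x - p ℓ y| ≤ Φ t)
    {g : X → ℝ} {O E : ℝ} (hE0 : 0 ≤ E) (hEO : E ≤ O)
    (hO : ∀ x ∈ K, ∀ y ∈ K, |g x - g y| ≤ O) (n : ℕ) (t : ℝ) (ht : 0 ≤ Φ t ∧ ∀ i : ℕ, 0 ≤ Φ (r ^ i * t))
    (hE : ∀ x ∈ K, ∀ y ∈ K, d x y ≤ r ^ n * t → |g x - g y| ≤ E) :
    ∀ x ∈ K, ∀ y ∈ K, d x y ≤ t → |(PU p W)^[n] g x - (PU p W)^[n] g y| ≤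
      O - (∏ i ∈ Finset.range n, (1 - min (Φ (r ^ i * t)) (1 - δ))) * (O - E) := by
  induction n generalizing t with
  | zero => intro x hx y hy h; simpa using hE x hx y hy (by simpa using h)
  | succ n ih =>
    intro x hx y hy h
    rw [Function.iterate_succ_apply']
    have ih' := ih (r * t) ⟨by simpa using ht.2 1, fun i => by
        have := ht.2 (i+1); rwa [pow_succ, mul_assoc] at this⟩
      (fun x hx y hy h => hE x hx y hy (by rw [pow_succ, mul_assoc]; exact h))
    have hprod : 0 ≤ ∏ i ∈ Finset.range n, (1 - min (Φ (r ^ i * (r * t))) (1 - δ)) := by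
      apply Finset.prod_nonneg; intro i _
      have := min_le_right (Φ (r ^ i * (r * t))) (1 - δ)
      linarith
    have := PU_step hps hδ hplb hK (E := O - (∏ i ∈ Finset.range n, (1 - min (Φ (r ^ i * (r * t))) (1 - δ))) * (O - E))
      (ε := min (Φ t) (1 - δ)) (g := (PU p W)^[n] g) (O := O) (by nlinarith)
      (PU_osc hps hδ hplb hK hO n) hx hy
      (fun ℓ => ih' _ (hK ℓ x hx) _ (hK ℓ y hy) ((hd ℓ x y).trans (by gcongr)))
      (min_le_min_right _ (hΦ x y t h))
    refine this.trans (le_of_eq ?_)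
    rw [Finset.prod_range_succ']
    simp only [pow_succ, mul_assoc, pow_zero, one_mul]
    ring

lemma prod_lower_s11 {δ : ℝ} (hδ : 0 < δ) (e : ℕ → ℝ) (he0 : ∀ i, 0 ≤ e i) (he : ∀ i, e i ≤ 1 - δ)
    {S : ℝ} (hS : ∀ n, ∑ i ∈ Finset.range n, e i ≤ S) (n : ℕ) :
    Real.exp (-(S / δ)) ≤ ∏ i ∈ Finset.range n, (1 - e i) := by
  have h1 : ∀ i, Real.exp (-(e i / δ)) ≤ 1 - e i := by
    intro i
    have a := he i
    have b := he0 i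
    have hpos : 0 < 1 - e i := by linarith
    rw [Real.exp_neg]
    apply inv_le_of_inv_le₀ hpos
    have : (1 - e i)⁻¹ ≤ e i / δ + 1 := by
      rw [inv_le_iff_one_le_mul₀ hpos]
      have : e i ≤ e i / δ * (1 - e i) := by
        rw [div_mul_eq_mul_div, le_div_iff₀ hδ]
        nlinarith
      nlinarith
    exact this.trans (Real.add_one_le_exp _)
  calc Real.exp (-(S / δ)) ≤ Real.exp (∑ i ∈ Finset.range n, -(e i / δ)) := by
        apply Real.exp_le_exp.2
        rw [Finset.sum_neg_distrib, ← Finset.sum_div]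
        have := hS n
        gcongr
    _ = ∏ i ∈ Finset.range n, Real.exp (-(e i / δ)) := Real.exp_sum _ _
    _ ≤ _ := Finset.prod_le_prod (fun i _ => (Real.exp_pos _).le) (fun i _ => h1 i)

/-- Uniform asymptotic stability on the invariant set. -/
lemma PU_stab {X : Type*} [PseudoMetricSpace X] {L : ℕ} {p : Fin L → X → ℝ} {W : Fin L → X → X}
    (hp : ∀ ℓ, Continuous (p ℓ)) (hW : ∀ ℓ, Continuous (W ℓ))
    (hps : ∀ x, ∑ ℓ, p ℓ x = 1)
    {δ : ℝ} (hδ : 0 < δ) (hδ1 : δ ≤ 1) (hplb : ∀ ℓ x, δ ≤ p ℓ x) {K : Set X}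
    (hKc : IsCompact K)
    (hK : ∀ ℓ, ∀ x ∈ K, W ℓ x ∈ K) {d : X → X → ℝ} {r : ℝ} (hr : 0 < r) (hr1 : r < 1)
    (hdd : ∀ x y, dist x y ≤ d x y)
    (hd : ∀ ℓ x y, d (W ℓ x) (W ℓ y) ≤ r * d x y) {Φ : ℝ → ℝ}
    (hΦ : ∀ x y t, d x y ≤ t → ∑ ℓ, |p ℓ x - p ℓ y| ≤ Φ t) {T S : ℝ}
    (hT : ∀ x ∈ K, ∀ y ∈ K, d x y ≤ T) (hΦ0 : ∀ i : ℕ, 0 ≤ Φ (r ^ i * T))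
    (hS : ∀ n, ∑ i ∈ Finset.range n, Φ (r ^ i * T) ≤ S)
    {f : X → ℝ} (hf : Continuous f) {M : ℝ} (hM : ∀ x, |f x| ≤ M) {ε : ℝ} (hε : 0 < ε) :
    ∃ m0, ∀ m ≥ m0, ∀ x ∈ K, ∀ y ∈ K, |(PU p W)^[m] f x - (PU p W)^[m] f y| ≤ ε := by
  set q := Real.exp (-(S / δ)) with hq
  have hq0 : 0 < q := Real.exp_pos _
  have hqp : ∀ n, q ≤ ∏ i ∈ Finset.range n, (1 - min (Φ (r ^ i * T)) (1 - δ)) := by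
    apply prod_lower_s11 hδ
    · intro i; exact le_min (hΦ0 i) (by linarith)
    · intro i; exact min_le_right _ _
    · intro n
      exact (Finset.sum_le_sum fun i _ => min_le_left _ _).trans (hS n)
  have hq1 : q ≤ 1 := by simpa using hqp 0
  have claim : ∀ j : ℕ, ∃ k, ∀ x ∈ K, ∀ y ∈ K,
      |(PU p W)^[k] f x - (PU p W)^[k] f y| ≤ (1 - q / 2) ^ j * (2 * |M| + 1) := by
    intro j
    induction j with
    | zero =>
      refine ⟨0, fun x _ y _ => ?_⟩
      simp only [Function.iterate_zero, id, pow_zero, one_mul]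
      have := abs_sub (f x) (f y)
      linarith [hM x, hM y, le_abs_self M]
    | succ j ih =>
      obtain ⟨k, hk⟩ := ih
      set O := (1 - q / 2) ^ j * (2 * |M| + 1) with hOdef
      have hO : 0 < O := by
        have : 0 < 1 - q / 2 := by linarith
        positivity
      have huc : UniformContinuousOn ((PU p W)^[k] f) K :=
        hKc.uniformContinuousOn_of_continuous (PU_cont hp hW hf k).continuousOn
      rw [Metric.uniformContinuousOn_iff] at huc
      obtain ⟨s, hs, hus⟩ := huc (O / 2) (by linarith)
      have hlim : Tendsto (fun n : ℕ => r ^ n * T) atTop (𝓝 0) := by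
        simpa using (tendsto_pow_atTop_nhds_zero_of_lt_one hr.le hr1).mul_const T
      obtain ⟨n, hn⟩ := (hlim.eventually (gt_mem_nhds hs)).exists
      refine ⟨n + k, fun x hx y hy => ?_⟩
      rw [Function.iterate_add_apply]
      have := PU_multi hps hδ hδ1 hplb hK hr hd hΦ (E := O / 2) (by linarith) (by linarith) hk n T
        ⟨by simpa using hΦ0 0, hΦ0⟩ (fun x hx y hy h => by
          have := hus x hx y hy (lt_of_le_of_lt ((hdd x y).trans h) hn)
          rw [Real.dist_eq] at this
          exact this.le) x hx y hy (hT x hx y hy)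
      refine this.trans ?_
      have h2 := hqp n
      rw [pow_succ]
      rw [show (1 - q / 2) ^ j * (1 - q / 2) * (2 * |M| + 1) = O - q * (O - O/2) by rw [hOdef]; ring]
      have : q * (O - O/2) ≤ (∏ i ∈ Finset.range n, (1 - min (Φ (r ^ i * T)) (1 - δ))) * (O - O / 2) :=
        mul_le_mul_of_nonneg_right h2 (by linarith)
      linarith
  have hlim : Tendsto (fun j : ℕ => (1 - q / 2) ^ j * (2 * |M| + 1)) atTop (𝓝 0) := by
    simpa using (tendsto_pow_atTop_nhds_zero_of_lt_one (r := 1 - q / 2) (by linarith) (by linarith)).mul_const (2 * |M| + 1)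
  obtain ⟨j, hj⟩ := (hlim.eventually (gt_mem_nhds hε)).exists
  obtain ⟨k, hk⟩ := claim j
  refine ⟨k, fun m hm x hx y hy => ?_⟩
  obtain ⟨i, rfl⟩ := Nat.exists_eq_add_of_le' hm
  rw [Function.iterate_add_apply]
  exact (PU_osc hps hδ hplb hK hk i x hx y hy).trans hj.le

open scoped Matrix.Norms.Operator in
lemma cpow_tendsto {n : ℕ} (B : Matrix (Fin n) (Fin n) ℂ) (hB : ∀ z ∈ spectrum ℂ B, ‖z‖ < 1) :
    ∀ i j, Tendsto (fun m : ℕ => (B ^ m) i j) atTop (𝓝 0) := by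
  intro i j
  have : Nonempty (Fin n) := ⟨i⟩
  have h1 : spectralRadius ℂ B < 1 := by
    obtain ⟨z, hz, h⟩ := spectrum.exists_nnnorm_eq_spectralRadius B
    rw [← h]
    have := hB z hz
    exact_mod_cast this
  obtain ⟨c, hc1, hc2⟩ := ENNReal.lt_iff_exists_nnreal_btwn.1 h1
  have h2 := spectrum.pow_nnnorm_pow_one_div_tendsto_nhds_spectralRadius B
  have h3 : ∀ᶠ m : ℕ in atTop, ‖B ^ m‖ ≤ (c : ℝ) ^ m := by
    filter_upwards [h2.eventually (gt_mem_nhds hc1), eventually_gt_atTop 0] with m hm hm0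
    have h4 : ((‖B ^ m‖₊ : ENNReal) ^ (1 / (m : ℝ))) ^ (m : ℝ) ≤ (c : ENNReal) ^ (m : ℝ) :=
      ENNReal.rpow_le_rpow hm.le (by positivity)
    rw [← ENNReal.rpow_mul, one_div, inv_mul_cancel₀ (by positivity), ENNReal.rpow_one,
      ENNReal.rpow_natCast] at h4
    exact_mod_cast h4
  have hc : (c : ℝ) < 1 := by exact_mod_cast hc2
  have h4 : Tendsto (fun m : ℕ => B ^ m) atTop (𝓝 0) :=
    squeeze_zero_norm' h3 (tendsto_pow_atTop_nhds_zero_of_lt_one c.2 hc)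
  have h5 : Continuous (fun C : Matrix (Fin n) (Fin n) ℂ => C i j) := by fun_prop
  have h6 := (h5.tendsto 0).comp h4
  exact h6

lemma schur_pow {n : ℕ} (A : Matrix (Fin n) (Fin n) ℝ) (hA : IsSchur A) :
    ∃ m : ℕ, 0 < m ∧ ‖(Matrix.toEuclideanCLM (n := Fin n) (𝕜 := ℝ) A) ^ m‖ ≤ 1 / 2 := by
  have h1 := cpow_tendsto _ hA
  have h2 : ∀ i j, Tendsto (fun m : ℕ => (A ^ m) i j) atTop (𝓝 0) := by
    intro i j
    have h3 : ∀ m : ℕ, ((A.map (fun x : ℝ => (x : ℂ))) ^ m) i j = (((A ^ m) i j : ℝ) : ℂ) := by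
      intro m
      have : (A.map (fun x : ℝ => (x : ℂ))) ^ m = (A ^ m).map (fun x : ℝ => (x : ℂ)) := by
        have := map_pow (Complex.ofRealHom.mapMatrix (m := Fin n)) A m
        exact this.symm
      rw [this]; rfl
    have h4 := (Complex.continuous_re.tendsto 0).comp (h1 i j)
    refine (h4.congr fun m => ?_)
    simp [h3]
  have h3 : Tendsto (fun m : ℕ => A ^ m) atTop (𝓝 0) := by
    refine tendsto_pi_nhds.2 fun i => ?_
    exact tendsto_pi_nhds.2 fun j => h2 i j
  have hcont : Continuous (fun B : Matrix (Fin n) (Fin n) ℝ => Matrix.toEuclideanCLM (n := Fin n) (𝕜 := ℝ) B) :=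
    (Matrix.toEuclideanCLM (n := Fin n) (𝕜 := ℝ)).toAlgEquiv.toLinearMap.continuous_of_finiteDimensional
  have h4 := (hcont.norm.tendsto 0).comp h3
  simp only [map_zero, norm_zero] at h4
  obtain ⟨m, hm, hm0⟩ := ((h4.eventually (gt_mem_nhds (show (0:ℝ) < 1/2 by norm_num))).and
    (eventually_gt_atTop 0)).exists
  refine ⟨m, hm0, ?_⟩
  rw [← map_pow]
  exact hm.le

lemma adapted {E : Type*} [NormedAddCommGroup E] [NormedSpace ℝ E] (T : E →L[ℝ] E) {m : ℕ}
    (hm : 0 < m) (hT : ‖T ^ m‖ ≤ 1 / 2) :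
    ∃ (N : E → ℝ) (C s : ℝ), 0 < s ∧ s < 1 ∧ 0 ≤ C ∧ (∀ z, ‖z‖ ≤ N z) ∧ (∀ z, N z ≤ C * ‖z‖) ∧
      (∀ x y, N (x + y) ≤ N x + N y) ∧ (∀ z, N (-z) = N z) ∧ ∀ z, N (T z) ≤ s * N z := by
  set s : ℝ := (1 / 2 : ℝ) ^ ((m : ℝ)⁻¹) with hs
  have hsm : s ^ m = 1 / 2 := Real.rpow_inv_natCast_pow (by norm_num) hm.ne'
  have hs0 : 0 < s := by positivity
  have hs1 : s < 1 := Real.rpow_lt_one (by norm_num) (by norm_num) (by positivity)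
  refine ⟨fun z => ∑ i ∈ Finset.range m, ‖(T ^ i) z‖ * (s ^ i)⁻¹,
    ∑ i ∈ Finset.range m, ‖T ^ i‖ * (s ^ i)⁻¹, s, hs0, hs1, by positivity, ?_, ?_, ?_, ?_, ?_⟩
  · intro z
    have := Finset.single_le_sum (s := Finset.range m) (f := fun i => ‖(T ^ i) z‖ * (s ^ i)⁻¹)
      (fun i _ => by positivity) (Finset.mem_range.2 hm)
    simpa using this
  · intro z
    simp only
    rw [Finset.sum_mul]
    apply Finset.sum_le_sum; intro i _
    have := (T ^ i).le_opNorm z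
    calc _ ≤ (‖T ^ i‖ * ‖z‖) * (s ^ i)⁻¹ := by gcongr
      _ = _ := by ring
  · intro x y
    simp only
    rw [← Finset.sum_add_distrib]
    apply Finset.sum_le_sum; intro i _
    rw [map_add, ← add_mul]
    gcongr
    exact norm_add_le _ _
  · intro z; simp
  · intro z
    simp only
    have e1 : ∀ i, ‖(T ^ i) (T z)‖ * (s ^ i)⁻¹ = s * (‖(T ^ (i+1)) z‖ * (s ^ (i+1))⁻¹) := by
      intro i
      rw [pow_succ T i, mul_apply_eq_comp, pow_succ s i]
      field_simp
    simp_rw [e1]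
    rw [← Finset.mul_sum]
    apply mul_le_mul_of_nonneg_left _ hs0.le
    have a := Finset.sum_range_succ (fun i => ‖(T ^ i) z‖ * (s ^ i)⁻¹) m
    have b := Finset.sum_range_succ' (fun i => ‖(T ^ i) z‖ * (s ^ i)⁻¹) m
    have c : ‖(T ^ m) z‖ * (s ^ m)⁻¹ ≤ ‖z‖ := by
      rw [hsm]
      have := (T ^ m).le_opNorm z
      have h := mul_le_mul_of_nonneg_right hT (norm_nonneg z)
      rw [show ((1 / 2 : ℝ))⁻¹ = 2 by norm_num]
      linarith
    simp only [pow_zero, one_apply_eq_self, inv_one, mul_one] at b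
    linarith

lemma dini_sum {φ : ℝ → ℝ} (hmono : MonotoneOn φ (Set.Ici 0)) (h0 : φ 0 = 0)
    (hint : IntervalIntegrable (fun t => φ t / t) volume 0 1) {r : ℝ} (hr : 0 < r) (hr1 : r < 1)
    {T : ℝ} (hT : 0 ≤ T) : Summable (fun i : ℕ => φ (r ^ i * T)) := by
  have hnn : ∀ t, 0 ≤ t → 0 ≤ φ t := fun t ht => by
    rw [← h0]; exact hmono (Set.mem_Ici.2 le_rfl) ht ht
  have hsub : ∀ i j : ℕ, IntervalIntegrable (fun t => φ t / t) volume (r ^ i) (r ^ j) := by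
    intro i j
    apply hint.mono_set
    apply Set.uIcc_subset_uIcc <;> rw [Set.uIcc_of_le zero_le_one]
    · exact ⟨by positivity, pow_le_one₀ hr.le hr1.le⟩
    · exact ⟨by positivity, pow_le_one₀ hr.le hr1.le⟩
  have hstep : ∀ i : ℕ, (1 - r) * φ (r ^ (i+1)) ≤ ∫ t in (r ^ (i+1))..(r ^ i), φ t / t := by
    intro i
    have hle : r ^ (i+1) ≤ r ^ i := pow_le_pow_of_le_one hr.le hr1.le (Nat.le_succ i)
    have := intervalIntegral.integral_mono_on (μ := volume) (f := fun _ => φ (r ^ (i+1)) / r ^ i) hle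
      (by simp) (hsub (i+1) i) (fun t ht => by
        have ht0 : 0 < t := lt_of_lt_of_le (by positivity) ht.1
        have := hmono (a := r ^ (i+1)) (b := t) (Set.mem_Ici.2 (by positivity)) (Set.mem_Ici.2 ht0.le) ht.1
        have h3 := hnn t ht0.le
        have h4 := ht.2
        gcongr)
    refine le_trans (le_of_eq ?_) this
    rw [intervalIntegral.integral_const, smul_eq_mul, pow_succ]
    field_simp
  have hsum1 : Summable (fun i : ℕ => (1 - r) * φ (r ^ (i+1))) := by
    apply summable_of_sum_range_le (c := ∫ t in (0:ℝ)..1, φ t / t)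
    · intro i; exact mul_nonneg (by linarith) (hnn _ (by positivity))
    · intro n
      have h1 : ∑ i ∈ Finset.range n, ∫ t in (r ^ (i+1))..(r ^ i), φ t / t
          = ∫ t in (r ^ n)..(r ^ 0), φ t / t := by
        have := intervalIntegral.sum_integral_adjacent_intervals (μ := volume) (f := fun t => φ t / t)
          (a := fun i : ℕ => r ^ i) (n := n) (fun k _ => hsub k (k+1))
        rw [intervalIntegral.integral_symm, ← this, ← Finset.sum_neg_distrib]
        apply Finset.sum_congr rfl; intro i _
        rw [intervalIntegral.integral_symm]
      refine (Finset.sum_le_sum fun i _ => hstep i).trans ?_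
      rw [h1, pow_zero]
      apply intervalIntegral.integral_mono_interval (by positivity) (pow_le_one₀ hr.le hr1.le) le_rfl _ hint
      rw [Filter.EventuallyLE, ae_restrict_iff' measurableSet_Ioc]
      exact Eventually.of_forall fun t ht => div_nonneg (hnn t ht.1.le) ht.1.le
  have hsum2 : Summable (fun i : ℕ => φ (r ^ (i+1))) := by
    have := hsum1.mul_left (1 - r)⁻¹
    refine this.congr fun i => ?_
    have : 1 - r ≠ 0 := by linarith
    field_simp
  have hlim : Tendsto (fun n : ℕ => r ^ n * T) atTop (𝓝 0) := by
    simpa using (tendsto_pow_atTop_nhds_zero_of_lt_one hr.le hr1).mul_const T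
  obtain ⟨j, hj⟩ := (hlim.eventually (gt_mem_nhds zero_lt_one)).exists
  rw [← summable_nat_add_iff (j+1)]
  apply Summable.of_nonneg_of_le _ _ hsum2
  · intro i; exact hnn _ (by positivity)
  · intro i
    apply hmono (Set.mem_Ici.2 (by positivity)) (Set.mem_Ici.2 (by positivity))
    calc r ^ (i + (j+1)) * T = r ^ (i+1) * (r ^ j * T) := by ring
      _ ≤ r ^ (i+1) * 1 := by gcongr
      _ = _ := mul_one _

lemma dini_cont {X : Type*} [PseudoMetricSpace X] {p : X → ℝ} (h : DiniContinuous p) :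
    Continuous p := by
  obtain ⟨φ, hm, h0, hi, hp⟩ := h
  have := (dini_sum hm h0 hi (r := 1/2) (by norm_num) (by norm_num) (T := 1) (by norm_num)).tendsto_atTop_zero
  rw [Metric.continuous_iff]
  intro b ε hε
  obtain ⟨i, hi⟩ := (this.eventually (gt_mem_nhds hε)).exists
  refine ⟨(1/2)^i * 1, by positivity, fun a ha => ?_⟩
  rw [Real.dist_eq]
  exact lt_of_le_of_lt ((hp a b).trans (hm (Set.mem_Ici.2 dist_nonneg) (Set.mem_Ici.2 (by positivity)) ha.le)) hi

/-- adapted norm for the closed loop -/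
lemma closed_loop {E F : Type*} [NormedAddCommGroup E] [NormedAddCommGroup F] [NormedSpace ℝ F]
    {L : ℕ} (T : F →L[ℝ] F) {m : ℕ}
    (hm : 0 < m) (hT : ‖T ^ m‖ ≤ 1 / 2) (w : Fin L → E → E) (l : Fin L → NNReal)
    (hl : ∀ ℓ, l ℓ < 1) (hw : ∀ ℓ, LipschitzWith (l ℓ) (w ℓ))
    (g : Fin L → E → F) (hg : ∀ ℓ, ∃ K : NNReal, LipschitzWith K (g ℓ))
    (W : Fin L → E × F → E × F) (hW : ∀ ℓ x z, W ℓ (x, z) = (w ℓ x, T z + g ℓ x)) :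
    ∃ (N : E × F → ℝ) (C r : ℝ), 0 < r ∧ r < 1 ∧ 0 ≤ C ∧ (∀ z, ‖z‖ ≤ N z) ∧ (∀ z, N z ≤ C * ‖z‖) ∧
      (∀ x y, N (x + y) ≤ N x + N y) ∧ (∀ z, N (-z) = N z) ∧
      ∀ ℓ x y, N (W ℓ x - W ℓ y) ≤ r * N (x - y) := by
  obtain ⟨N, C, s, hs0, hs1, hC, hN1, hN2, hNadd, hNneg, hNT⟩ := adapted T hm hT
  choose K hK using hg
  obtain ⟨B, hB⟩ : ∃ B : ℝ, ∀ ℓ, (K ℓ : ℝ) ≤ B := by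
    obtain ⟨B, hB⟩ := (Set.finite_range fun ℓ => (K ℓ : ℝ)).bddAbove
    exact ⟨B, fun ℓ => hB ⟨ℓ, rfl⟩⟩
  obtain ⟨a, ha0, ha1, ha⟩ : ∃ a : ℝ, 0 ≤ a ∧ a < 1 ∧ ∀ ℓ, (l ℓ : ℝ) ≤ a := by
    refine ⟨(Finset.univ.sup l : NNReal), NNReal.coe_nonneg _, ?_, fun ℓ => ?_⟩
    · have : Finset.univ.sup l < 1 := (Finset.sup_lt_iff (by simp)).2 fun ℓ _ => hl ℓ
      exact_mod_cast this
    · exact_mod_cast Finset.le_sup (f := l) (Finset.mem_univ ℓ)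
  set D : ℝ := max 1 (C * B / ((1 - a) / 2)) with hD
  have hD1 : 1 ≤ D := le_max_left _ _
  have hD2 : C * B ≤ D * ((1 - a) / 2) := by
    rw [← div_le_iff₀ (by linarith)]; exact le_max_right _ _
  have hN0 : ∀ z, 0 ≤ N z := fun z => (norm_nonneg z).trans (hN1 z)
  refine ⟨fun v => D * ‖v.1‖ + N v.2, D + C, max s ((1 + a) / 2), lt_max_of_lt_left hs0,
    max_lt hs1 (by linarith), by linarith, ?_, ?_, ?_, ?_, ?_⟩
  · rintro ⟨x, z⟩
    rw [Prod.norm_mk]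
    have := norm_nonneg x
    have h2 := hN0 z
    have h3 := hN1 z
    apply max_le <;> simp only <;> nlinarith
  · rintro ⟨x, z⟩
    have h1 : ‖x‖ ≤ ‖(x, z)‖ := norm_fst_le (x, z)
    have h2 : ‖z‖ ≤ ‖(x, z)‖ := norm_snd_le (x, z)
    have := hN2 z
    have h3 : D * ‖x‖ ≤ D * ‖(x, z)‖ := by gcongr
    have h4 : C * ‖z‖ ≤ C * ‖(x, z)‖ := by gcongr
    simp only
    linarith
  · rintro ⟨x, z⟩ ⟨x', z'⟩
    simp only [Prod.mk_add_mk]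
    have h1 := hNadd z z'
    have : D * ‖x + x'‖ ≤ D * (‖x‖ + ‖x'‖) := by gcongr; exact norm_add_le _ _
    linarith
  · rintro ⟨x, z⟩
    simp [hNneg]
  · rintro ℓ ⟨x, z⟩ ⟨x', z'⟩
    rw [hW, hW]
    simp only [Prod.mk_sub_mk]
    have e1 : T z + g ℓ x - (T z' + g ℓ x') = T (z - z') + (g ℓ x - g ℓ x') := by
      rw [map_sub]; abel
    rw [e1]
    have h1 := hNadd (T (z - z')) (g ℓ x - g ℓ x')
    have h2 := hNT (z - z')
    have h3 := hN2 (g ℓ x - g ℓ x')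
    have h4 : ‖g ℓ x - g ℓ x'‖ ≤ B * ‖x - x'‖ := by
      refine ((hK ℓ).norm_sub_le x x').trans ?_
      have := hB ℓ
      gcongr
    have h5 : ‖w ℓ x - w ℓ x'‖ ≤ a * ‖x - x'‖ := by
      refine ((hw ℓ).norm_sub_le x x').trans ?_
      have := ha ℓ
      gcongr
    have h6 : C * ‖g ℓ x - g ℓ x'‖ ≤ (C * B) * ‖x - x'‖ := by
      rw [mul_assoc]; gcongr
    have h7 : (C * B) * ‖x - x'‖ ≤ (D * ((1 - a) / 2)) * ‖x - x'‖ := by gcongr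
    have h8 : D * ‖w ℓ x - w ℓ x'‖ ≤ D * (a * ‖x - x'‖) := by gcongr
    have h9 : (1 + a) / 2 * (D * ‖x - x'‖) ≤ max s ((1 + a) / 2) * (D * ‖x - x'‖) := by
      gcongr; exact le_max_right _ _
    have h10 : s * N (z - z') ≤ max s ((1 + a) / 2) * N (z - z') := by
      have := hN0 (z - z')
      gcongr; exact le_max_left _ _
    linarith

lemma integral_bind_sum {Y Z : Type*} [MeasurableSpace Y] [MeasurableSpace Z] {L : ℕ}
    (μ : Measure Y) [SFinite μ] (a : Fin L → Y → ℝ) (b : Fin L → Y → Z)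
    (ha : ∀ ℓ, Measurable (a ℓ)) (hb : ∀ ℓ, Measurable (b ℓ)) (ha0 : ∀ ℓ y, 0 ≤ a ℓ y)
    (ν : Measure Z) [IsFiniteMeasure ν]
    (hν : μ.bind (fun y => ∑ ℓ, ENNReal.ofReal (a ℓ y) • Measure.dirac (b ℓ y)) = ν)
    {F : Z → ℝ} (hF : Measurable F) {M : ℝ} (hM : ∀ z, |F z| ≤ M) :
    ∫ z, F z ∂ν = ∫ y, ∑ ℓ, a ℓ y * F (b ℓ y) ∂μ := by
  have hk : Measurable (fun y => ∑ ℓ, ENNReal.ofReal (a ℓ y) • Measure.dirac (b ℓ y)) := by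
    apply Measure.measurable_of_measurable_coe
    intro s hs
    simp only [Measure.coe_finsetSum, Finset.sum_apply, Measure.smul_apply, smul_eq_mul]
    apply Finset.measurable_sum
    intro ℓ _
    apply Measurable.mul
    · exact (ha ℓ).ennreal_ofReal
    · exact (Measure.measurable_coe hs).comp (Measure.measurable_dirac.comp (hb ℓ))
  let η : ProbabilityTheory.Kernel Y Z := ⟨_, hk⟩
  have h1 : (η.comp (ProbabilityTheory.Kernel.const Unit μ)) () = ν := by
    rw [ProbabilityTheory.Kernel.comp_apply, ProbabilityTheory.Kernel.const_apply]
    exact hν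
  have hint : Integrable F ((η.comp (ProbabilityTheory.Kernel.const Unit μ)) ()) := by
    rw [h1]
    exact Integrable.of_bound hF.aestronglyMeasurable M (Eventually.of_forall hM)
  have h2 := ProbabilityTheory.Kernel.integral_comp hint
  rw [h1, ProbabilityTheory.Kernel.const_apply] at h2
  rw [h2]
  congr 1
  ext y
  change ∫ z, F z ∂(∑ ℓ, ENNReal.ofReal (a ℓ y) • Measure.dirac (b ℓ y)) = _
  rw [integral_finsetSum_measure]
  · apply Finset.sum_congr rfl
    intro ℓ _
    rw [integral_smul_measure, integral_dirac' _ _ hF.stronglyMeasurable,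
      ENNReal.toReal_ofReal (ha0 ℓ y), smul_eq_mul]
  · intro ℓ _
    exact Integrable.of_bound (C := M) hF.aestronglyMeasurable (Eventually.of_forall hM)
      |>.smul_measure ENNReal.ofReal_ne_top

lemma PU_meas {X : Type*} [MeasurableSpace X] {L : ℕ} {p : Fin L → X → ℝ} {W : Fin L → X → X}
    (hp : ∀ ℓ, Measurable (p ℓ)) (hW : ∀ ℓ, Measurable (W ℓ)) {h : X → ℝ} (hh : Measurable h) :
    Measurable (PU p W h) := by
  unfold PU
  exact Finset.measurable_sum _ fun ℓ _ => (hp ℓ).mul (hh.comp (hW ℓ))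

lemma inv_PU {X : Type*} [MeasurableSpace X] {L : ℕ} {p : Fin L → X → ℝ} {W : Fin L → X → X}
    (hp : ∀ ℓ, Measurable (p ℓ)) (hW : ∀ ℓ, Measurable (W ℓ)) (hp0 : ∀ ℓ x, 0 ≤ p ℓ x)
    (hps : ∀ x, ∑ ℓ, p ℓ x = 1) {μ : Measure X} [IsProbabilityMeasure μ]
    (hinv : Invariant (IFSKernel p W) μ)
    {h : X → ℝ} (hh : Measurable h) {M : ℝ} (hM : ∀ x, |h x| ≤ M) (n : ℕ) :
    ∫ x, (PU p W)^[n] h x ∂μ = ∫ x, h x ∂μ := by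
  induction n generalizing h with
  | zero => rfl
  | succ n ih =>
    rw [Function.iterate_succ_apply, ih (PU_meas hp hW hh) (PU_bound hp0 hps hM)]
    exact (integral_bind_sum μ p W hp hW hp0 μ hinv hh hM).symm

lemma markov_orth {X : Type*} [MeasurableSpace X] {L : ℕ} {p : Fin L → X → ℝ} {W : Fin L → X → X}
    (hp : ∀ ℓ, Measurable (p ℓ)) (hW : ∀ ℓ, Measurable (W ℓ)) (hp0 : ∀ ℓ x, 0 ≤ p ℓ x)
    (hps : ∀ x, ∑ ℓ, p ℓ x = 1) {x₀ : X} {P : Measure (ℕ → X)}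
    (hP : IsMarkovLaw (IFSKernel p W) x₀ P)
    {h : X → ℝ} (hh : Measurable h) {M : ℝ} (hM : ∀ x, |h x| ≤ M) (n : ℕ)
    {H : (ℕ → X) → ℝ} (hH : Measurable H) {C : ℝ} (hC : ∀ ω, |H ω| ≤ C)
    (hdep : ∀ ω ω' : ℕ → X, (∀ i ≤ n, ω i = ω' i) → H ω = H ω') :
    ∫ ω, H ω * (h (ω (n + 1)) - PU p W h (ω n)) ∂P = 0 := by
  obtain ⟨hprob, hfd⟩ := hP
  have hmeas : ∀ n : ℕ, Measurable (fun (ω : ℕ → X) (i : Fin (n + 1)) => ω (i : ℕ)) := by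
    intro n; fun_prop
  have hpr : ∀ n, IsProbabilityMeasure (fdd (IFSKernel p W) x₀ n) := by
    intro n; rw [← hfd n]; exact Measure.isProbabilityMeasure_map (hmeas n).aemeasurable
  have hUm := PU_meas hp hW hh
  have hUb := PU_bound (W := W) hp0 hps hM
  have hsn : ∀ v : Fin (n + 1) → X, Measurable (fun x : X => (Fin.snoc v x : Fin (n + 2) → X)) := by
    intro v
    rw [measurable_pi_iff]
    intro i
    refine Fin.lastCases ?_ (fun j => ?_) i
    · simpa using! measurable_id
    · simp
  have hsn2 : ∀ ℓ, Measurable (fun v : Fin (n + 1) → X => (Fin.snoc v (W ℓ (v (Fin.last n))) : Fin (n + 2) → X)) := by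
    intro ℓ
    rw [measurable_pi_iff]
    intro i
    refine Fin.lastCases ?_ (fun j => ?_) i
    · simpa using! (hW ℓ).comp (measurable_pi_apply (Fin.last n))
    · simpa using measurable_pi_apply j
  have hstep : (fdd (IFSKernel p W) x₀ n).bind (fun v => ∑ ℓ, ENNReal.ofReal (p ℓ (v (Fin.last n))) •
      Measure.dirac (Fin.snoc v (W ℓ (v (Fin.last n))) : Fin (n + 2) → X)) = fdd (IFSKernel p W) x₀ (n + 1) := by
    rw [fdd]
    congr 1
    ext1 v
    unfold IFSKernel
    have : ∀ s : Finset (Fin L), (∑ ℓ ∈ s, ENNReal.ofReal (p ℓ (v (Fin.last n))) • Measure.dirac (W ℓ (v (Fin.last n)))).map (fun x : X => (Fin.snoc v x : Fin (n + 2) → X))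
      = ∑ ℓ ∈ s, ENNReal.ofReal (p ℓ (v (Fin.last n))) •
      Measure.dirac (Fin.snoc v (W ℓ (v (Fin.last n))) : Fin (n + 2) → X) := by
      intro s
      classical
      induction s using Finset.induction_on with
      | empty => simp
      | insert a s ha ih =>
        rw [Finset.sum_insert ha, Finset.sum_insert ha, Measure.map_add _ _ (hsn v), ih, Measure.map_smul,
          Measure.map_dirac' (hsn v)]
    exact (this _).symm
  -- test function
  let ext : (Fin (n + 2) → X) → (ℕ → X) := fun v i => v ⟨min i n, by omega⟩
  have hext : Measurable ext := by
    rw [measurable_pi_iff]; intro i; exact measurable_pi_apply _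
  let F : (Fin (n + 2) → X) → ℝ := fun v =>
    H (ext v) * (h (v (Fin.last (n + 1))) - PU p W h (v (Fin.last n).castSucc))
  have hFm : Measurable F := by
    apply Measurable.mul (hH.comp hext)
    exact (hh.comp (measurable_pi_apply _)).sub (hUm.comp (measurable_pi_apply _))
  have hFb : ∀ v, |F v| ≤ C * (M + M) := by
    intro v
    simp only [F]
    rw [abs_mul]
    have h1 := hC (ext v)
    have h2 := hM (v (Fin.last (n + 1)))
    have h3 := hUb (v (Fin.last n).castSucc)
    have h4 := abs_sub (h (v (Fin.last (n + 1)))) (PU p W h (v (Fin.last n).castSucc))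
    exact mul_le_mul h1 (by linarith) (abs_nonneg _) ((abs_nonneg _).trans h1)
  have e1 : ∫ ω, H ω * (h (ω (n + 1)) - PU p W h (ω n)) ∂P = ∫ v, F v ∂(fdd (IFSKernel p W) x₀ (n + 1)) := by
    rw [← hfd (n + 1), integral_map (hmeas (n+1)).aemeasurable hFm.aestronglyMeasurable]
    congr 1
    ext ω
    simp only [F, Fin.val_last, Fin.val_castSucc]
    congr 1
    apply hdep
    intro i hi
    simp [ext, hi]
  have := hpr n
  have := hpr (n + 1)
  rw [e1, integral_bind_sum (fdd (IFSKernel p W) x₀ n) _ _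
    (fun ℓ => (hp ℓ).comp (measurable_pi_apply (Fin.last n))) hsn2 (fun ℓ v => hp0 ℓ _) _ hstep hFm hFb]
  have : ∀ v : Fin (n + 1) → X, ∑ ℓ, (p ℓ ∘ fun v : Fin (n + 1) → X => v (Fin.last n)) v *
      F (Fin.snoc v (W ℓ (v (Fin.last n)))) = 0 := by
    intro v
    have hFv : ∀ ℓ, F (Fin.snoc v (W ℓ (v (Fin.last n)))) =
        H (fun i => v ⟨min i n, by omega⟩) * (h (W ℓ (v (Fin.last n))) - PU p W h (v (Fin.last n))) := by
      intro ℓ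
      simp only [F, Fin.snoc_last, Fin.snoc_castSucc]
      congr 2
      ext1 i
      simp only [ext]
      exact Fin.snoc_castSucc (α := fun _ => X) _ v ⟨min i n, by omega⟩
    simp_rw [hFv, Function.comp]
    have : ∀ ℓ, p ℓ (v (Fin.last n)) * (H (fun i => v ⟨min i n, by omega⟩) * (h (W ℓ (v (Fin.last n))) - PU p W h (v (Fin.last n))))
      = H (fun i => v ⟨min i n, by omega⟩) * (p ℓ (v (Fin.last n)) * h (W ℓ (v (Fin.last n)))
        - p ℓ (v (Fin.last n)) * PU p W h (v (Fin.last n))) := by intro ℓ; ring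
    simp_rw [this]
    rw [← Finset.mul_sum, Finset.sum_sub_distrib, ← Finset.sum_mul, hps, one_mul]
    simp [PU]
  simp_rw [this]
  simp

lemma slln_aux {Ω : Type*} [MeasurableSpace Ω] {P : Measure Ω} [IsProbabilityMeasure P]
    (S : ℕ → Ω → ℝ) (hm : ∀ n, Measurable (S n)) {B : ℝ} (hB0 : 0 ≤ B) (h0 : ∀ ω, S 0 ω = 0)
    (hB : ∀ n ω, |S (n + 1) ω - S n ω| ≤ B) (h2 : ∀ n, ∫ ω, (S n ω) ^ 2 ∂P ≤ B ^ 2 * n) :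
    ∀ᵐ ω ∂P, Tendsto (fun n : ℕ => S n ω / n) atTop (𝓝 0) := by
  have hadd : ∀ n k ω, |S (n + k) ω - S n ω| ≤ B * k := by
    intro n k ω
    induction k with
    | zero => simp
    | succ k ih =>
      have a := hB (n + k) ω
      have := abs_add_le (S (n + k + 1) ω - S (n + k) ω) (S (n + k) ω - S n ω)
      rw [← add_assoc, show S (n + k + 1) ω - S n ω = (S (n + k + 1) ω - S (n + k) ω) + (S (n + k) ω - S n ω) by ring]
      push_cast
      linarith
  have hbd : ∀ n ω, |S n ω| ≤ B * n := by
    intro n ω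
    have := hadd 0 n ω
    rwa [zero_add, h0, sub_zero] at this
  let y : ℕ → Ω → ℝ := fun n ω => (S (n ^ 2) ω / (n : ℝ) ^ 2) ^ 2
  have hym : ∀ n, Measurable (y n) := fun n => ((hm _).div_const _).pow_const 2
  have hy : ∀ n, ∫⁻ ω, ENNReal.ofReal (y n ω) ∂P ≤ ENNReal.ofReal (B ^ 2 * (1 / (n : ℝ) ^ 2)) := by
    intro n
    rw [← ofReal_integral_eq_lintegral_ofReal]
    · apply ENNReal.ofReal_le_ofReal
      simp only [y, div_pow]
      rw [integral_div]
      have := h2 (n ^ 2)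
      rcases Nat.eq_zero_or_pos n with h | h
      · subst h; simp
      · rw [div_le_iff₀ (by positivity)]
        refine this.trans (le_of_eq ?_)
        push_cast
        field_simp
    · apply Integrable.of_bound (hym n).aestronglyMeasurable ((B * ((n^2 : ℕ) : ℝ) / (n : ℝ) ^ 2) ^ 2)
      refine Eventually.of_forall fun ω => ?_
      simp only [y]
      rw [norm_pow, norm_div, Real.norm_eq_abs, Real.norm_eq_abs ((n:ℝ)^2), abs_of_nonneg (by positivity : (0:ℝ) ≤ (n:ℝ)^2)]
      have := hbd (n^2) ω
      gcongr
    · exact Eventually.of_forall fun ω => sq_nonneg _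
  have hsum : ∫⁻ ω, ∑' n, ENNReal.ofReal (y n ω) ∂P ≠ ⊤ := by
    rw [lintegral_tsum fun n => (hym n).ennreal_ofReal.aemeasurable]
    have hs : Summable (fun n : ℕ => B ^ 2 * (1 / (n : ℝ) ^ 2)) :=
      (Real.summable_one_div_nat_pow.2 (by norm_num)).mul_left _
    refine ne_top_of_le_ne_top ?_ (ENNReal.tsum_le_tsum hy)
    rw [← ENNReal.ofReal_tsum_of_nonneg (fun n => by positivity) hs]
    exact ENNReal.ofReal_ne_top
  have hae := ae_lt_top (Measurable.tsum fun n => (hym n).ennreal_ofReal) hsum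
  filter_upwards [hae] with ω hω
  have t1 := ENNReal.tendsto_atTop_zero_of_tsum_ne_top hω.ne
  have t2 : Tendsto (fun n => y n ω) atTop (𝓝 0) := by
    have := (ENNReal.tendsto_toReal ENNReal.zero_ne_top).comp t1
    refine this.congr fun n => ?_
    simp only [Function.comp]
    exact ENNReal.toReal_ofReal (sq_nonneg _)
  have t3 : Tendsto (fun n : ℕ => |S (n ^ 2) ω / (n : ℝ) ^ 2|) atTop (𝓝 0) := by
    have := (Real.continuous_sqrt.tendsto 0).comp t2
    rw [Real.sqrt_zero] at this
    refine this.congr fun n => ?_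
    exact Real.sqrt_sq_eq_abs _
  have t4 : Tendsto (fun n : ℕ => |S (n ^ 2) ω / (n : ℝ) ^ 2| + 2 * B * (1 / (n : ℝ))) atTop (𝓝 0) := by
    have := t3.add (tendsto_one_div_atTop_nhds_zero_nat.const_mul (2 * B))
    simpa using this
  have hsq : Tendsto Nat.sqrt atTop atTop := by
    rw [tendsto_atTop]
    intro b
    filter_upwards [eventually_ge_atTop (b * b)] with a ha
    exact Nat.le_sqrt.2 ha
  have t5 := t4.comp hsq
  apply squeeze_zero_norm' _ t5
  filter_upwards [eventually_ge_atTop 1] with k hk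
  set n := Nat.sqrt k with hn
  have hn1 : 1 ≤ n := Nat.le_sqrt.2 (by simpa using hk)
  have hk1 : n ^ 2 ≤ k := by rw [pow_two]; exact Nat.sqrt_le k
  have hk2 : k ≤ n ^ 2 + 2 * n := by have := Nat.sqrt_le_add k; rw [← hn] at this; nlinarith
  obtain ⟨j, hj⟩ := Nat.exists_eq_add_of_le hk1
  have hj2 : j ≤ 2 * n := by omega
  simp only [Function.comp]
  rw [← hn, norm_div, Real.norm_eq_abs, Real.norm_natCast, abs_div, abs_of_nonneg (by positivity : (0:ℝ) ≤ (n:ℝ)^2)]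
  have hnp : (0:ℝ) < n := by exact_mod_cast hn1
  have a1 : |S k ω| ≤ |S (n^2) ω| + B * (2 * n) := by
    have b1 := hadd (n^2) j ω
    rw [← hj] at b1
    have b2 := abs_add_le (S (n^2) ω) (S k ω - S (n^2) ω)
    rw [add_sub_cancel] at b2
    have b3 : B * (j:ℝ) ≤ B * (2 * n) := by
      gcongr; exact_mod_cast hj2
    linarith
  have hk3 : (n:ℝ)^2 ≤ k := by exact_mod_cast hk1
  calc |S k ω| / k ≤ (|S (n^2) ω| + B * (2 * n)) / (n:ℝ)^2 := by gcongr
    _ = |S (n^2) ω| / (n:ℝ)^2 + 2 * B * (1 / (n:ℝ)) := by field_simp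

lemma markov_slln {X : Type*} [MeasurableSpace X] {L : ℕ} {p : Fin L → X → ℝ} {W : Fin L → X → X}
    (hp : ∀ ℓ, Measurable (p ℓ)) (hW : ∀ ℓ, Measurable (W ℓ)) (hp0 : ∀ ℓ x, 0 ≤ p ℓ x)
    (hps : ∀ x, ∑ ℓ, p ℓ x = 1) {x₀ : X} {P : Measure (ℕ → X)}
    (hP : IsMarkovLaw (IFSKernel p W) x₀ P)
    {h : X → ℝ} (hh : Measurable h) {M : ℝ} (hM : ∀ x, |h x| ≤ M) :
    ∀ᵐ ω ∂P, Tendsto (fun n : ℕ => (∑ j ∈ Finset.range n, (h (ω (j + 1)) - PU p W h (ω j))) / n)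
      atTop (𝓝 0) := by
  have hprob := hP.1
  have hUm := PU_meas hp hW hh
  have hUb := PU_bound (W := W) hp0 hps hM
  have hM0 : 0 ≤ M := (abs_nonneg _).trans (hM x₀)
  let D : ℕ → (ℕ → X) → ℝ := fun j ω => h (ω (j + 1)) - PU p W h (ω j)
  have hDm : ∀ j, Measurable (D j) := fun j =>
    (hh.comp (measurable_pi_apply _)).sub (hUm.comp (measurable_pi_apply _))
  have hDb : ∀ j ω, |D j ω| ≤ 2 * M := by
    intro j ω
    have := abs_sub (h (ω (j + 1))) (PU p W h (ω j))
    simp only [D]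
    linarith [hM (ω (j+1)), hUb (ω j)]
  have hSm : ∀ n, Measurable (fun ω => ∑ j ∈ Finset.range n, D j ω) := fun n =>
    Finset.measurable_sum _ fun j _ => hDm j
  have hSb : ∀ n ω, |∑ j ∈ Finset.range n, D j ω| ≤ n * (2 * M) := by
    intro n ω
    refine (Finset.abs_sum_le_sum_abs _ _).trans ?_
    refine (Finset.sum_le_sum fun j _ => hDb j ω).trans (le_of_eq ?_)
    simp
  apply slln_aux (fun n ω => ∑ j ∈ Finset.range n, D j ω) hSm (B := 2 * M) (by linarith) (by simp)
  · intro n ω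
    rw [Finset.sum_range_succ, add_sub_cancel_left]; exact hDb n ω
  · intro n
    induction n with
    | zero => simp
    | succ n ih =>
      have horth := markov_orth hp hW hp0 hps hP hh hM n (hSm n) (hSb n) (by
        intro ω ω' hω
        apply Finset.sum_congr rfl
        intro j hj
        have := Finset.mem_range.1 hj
        simp only [D]
        rw [hω (j+1) (by omega), hω j (by omega)])
      have i1 : Integrable (fun ω => (∑ j ∈ Finset.range n, D j ω) ^ 2) P := by
        apply Integrable.of_bound ((hSm n).pow_const 2).aestronglyMeasurable ((n * (2 * M)) ^ 2)
        refine Eventually.of_forall fun ω => ?_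
        rw [norm_pow, Real.norm_eq_abs]
        have := hSb n ω
        gcongr
      have i2 : Integrable (fun ω => (∑ j ∈ Finset.range n, D j ω) * D n ω) P := by
        apply Integrable.of_bound ((hSm n).mul (hDm n)).aestronglyMeasurable ((n * (2 * M)) * (2 * M))
        refine Eventually.of_forall fun ω => ?_
        change ‖(∑ j ∈ Finset.range n, D j ω) * D n ω‖ ≤ _
        rw [norm_mul, Real.norm_eq_abs, Real.norm_eq_abs]
        have := hSb n ω
        have := hDb n ω
        gcongr
      have i3 : Integrable (fun ω => (D n ω) ^ 2) P := by
        apply Integrable.of_bound ((hDm n).pow_const 2).aestronglyMeasurable ((2 * M) ^ 2)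
        refine Eventually.of_forall fun ω => ?_
        rw [norm_pow, Real.norm_eq_abs]
        have := hDb n ω
        gcongr
      have i4 : ∫ ω, (D n ω) ^ 2 ∂P ≤ (2 * M) ^ 2 := by
        have := integral_mono i3 (integrable_const ((2 * M) ^ 2)) (fun ω => by
          have := hDb n ω
          simp only
          rw [← sq_abs]
          gcongr)
        simpa using this
      have : ∀ ω, (∑ j ∈ Finset.range (n + 1), D j ω) ^ 2 = (∑ j ∈ Finset.range n, D j ω) ^ 2 +
          2 * ((∑ j ∈ Finset.range n, D j ω) * D n ω) + (D n ω) ^ 2 := by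
        intro ω; rw [Finset.sum_range_succ]; ring
      simp_rw [this]
      have i5 : Integrable (fun ω => (∑ j ∈ Finset.range n, D j ω) ^ 2 +
          2 * ((∑ j ∈ Finset.range n, D j ω) * D n ω)) P := i1.add (i2.const_mul 2)
      rw [integral_add i5 i3, integral_add i1 (i2.const_mul 2), integral_const_mul]
      have horth' : ∫ ω, (∑ j ∈ Finset.range n, D j ω) * D n ω ∂P = 0 := horth
      rw [horth']
      push_cast
      linarith

lemma markov_inv {X : Type*} [MeasurableSpace X] {L : ℕ} {p : Fin L → X → ℝ} {W : Fin L → X → X}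
    (hp : ∀ ℓ, Measurable (p ℓ)) (hW : ∀ ℓ, Measurable (W ℓ)) (hp0 : ∀ ℓ x, 0 ≤ p ℓ x)
    (hps : ∀ x, ∑ ℓ, p ℓ x = 1) {x₀ : X} {P : Measure (ℕ → X)}
    (hP : IsMarkovLaw (IFSKernel p W) x₀ P) {K : Set X} (hKm : MeasurableSet K)
    (hK : ∀ ℓ, ∀ x ∈ K, W ℓ x ∈ K) (hx₀ : x₀ ∈ K) : ∀ᵐ ω ∂P, ∀ j, ω j ∈ K := by
  have hprob := hP.1
  rw [ae_all_iff]
  intro j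
  induction j with
  | zero =>
    have h0 := hP.2 0
    have hm : Measurable (fun (ω : ℕ → X) (i : Fin (0 + 1)) => ω (i : ℕ)) := by fun_prop
    have hs : MeasurableSet {v : Fin (0 + 1) → X | v 0 ∈ K} := measurable_pi_apply 0 hKm
    have : ∀ᵐ v ∂(P.map (fun (ω : ℕ → X) (i : Fin (0 + 1)) => ω (i : ℕ))), v 0 ∈ K := by
      rw [h0, fdd, ae_dirac_iff hs]; exact hx₀
    exact (ae_map_iff hm.aemeasurable hs).1 this
  | succ n ih =>
    let h : X → ℝ := Kᶜ.indicator (fun _ => 1)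
    have hh : Measurable h := measurable_const.indicator hKm.compl
    have hb : ∀ x, |h x| ≤ 1 := by
      intro x
      by_cases hx : x ∈ K <;> simp [h, hx]
    have := markov_orth hp hW hp0 hps hP hh hb n (H := fun _ => 1) measurable_const (C := 1) (by simp)
      (fun _ _ _ => rfl)
    have hU : ∀ᵐ ω ∂P, (1:ℝ) * (h (ω (n + 1)) - PU p W h (ω n)) = h (ω (n + 1)) := by
      filter_upwards [ih] with ω hω
      have : PU p W h (ω n) = 0 := by
        unfold PU
        apply Finset.sum_eq_zero
        intro ℓ _
        simp [h, hK ℓ _ hω]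
      rw [this]; ring
    rw [integral_congr_ae hU, integral_eq_zero_iff_of_nonneg] at this
    · filter_upwards [this] with ω hω
      by_contra hc
      simp [h, hc] at hω
    · intro ω
      exact Set.indicator_nonneg (fun _ _ => zero_le_one) _
    · exact Integrable.of_bound (hh.comp (measurable_pi_apply _)).aestronglyMeasurable 1
        (Eventually.of_forall fun ω => hb _)

lemma avg_aux {X : Type*} (ω : ℕ → X) (h : ℕ → X → ℝ) {M c : ℝ} (hM : ∀ m x, |h m x| ≤ M)
    (hD : ∀ m, Tendsto (fun n : ℕ => (∑ j ∈ Finset.range n, (h m (ω (j + 1)) - h (m + 1) (ω j))) / n)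
      atTop (𝓝 0))
    (hc : ∀ ε > 0, ∃ m, ∀ j, |h m (ω j) - c| ≤ ε) :
    Tendsto (fun n : ℕ => (∑ j ∈ Finset.range n, h 0 (ω j)) / n) atTop (𝓝 c) := by
  have h1 : ∀ m, Tendsto (fun n : ℕ => (∑ j ∈ Finset.range n, (h 0 (ω j) - h m (ω j))) / n) atTop (𝓝 0) := by
    intro m
    induction m with
    | zero => simp
    | succ m ih =>
      have ht : Tendsto (fun n : ℕ => (h m (ω 0) - h m (ω n)) / n) atTop (𝓝 0) := by
        have h3 : Tendsto (fun n : ℕ => 2 * M * (1 / (n : ℝ))) atTop (𝓝 0) := by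
          simpa using tendsto_one_div_atTop_nhds_zero_nat.const_mul (2 * M)
        apply squeeze_zero_norm _ h3
        intro n
        rw [norm_div, Real.norm_eq_abs, Real.norm_natCast, mul_one_div]
        have a1 := abs_sub (h m (ω 0)) (h m (ω n))
        have a2 := hM m (ω 0)
        have a3 := hM m (ω n)
        gcongr
        linarith
      have := (ih.add ht).add (hD m)
      simp only [add_zero] at this
      refine this.congr fun n => ?_
      rw [← add_div, ← add_div, ← Finset.sum_range_sub' (fun j => h m (ω j)) n, ← Finset.sum_add_distrib,
        ← Finset.sum_add_distrib]
      congr 1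
      apply Finset.sum_congr rfl
      intro j _
      ring
  rw [Metric.tendsto_atTop']
  intro ε hε
  obtain ⟨m, hm⟩ := hc (ε / 2) (by linarith)
  obtain ⟨n0, hn0⟩ := Metric.tendsto_atTop'.1 (h1 m) (ε / 2) (by linarith)
  refine ⟨n0, fun n hn => ?_⟩
  have h2 := hn0 n hn
  rw [Real.dist_eq] at h2 ⊢
  have hnp : (0:ℝ) < n := by exact_mod_cast (lt_of_le_of_lt (Nat.zero_le _) hn)
  have e : (∑ j ∈ Finset.range n, h 0 (ω j)) / n - c =
      ((∑ j ∈ Finset.range n, (h 0 (ω j) - h m (ω j))) / n - 0) + (∑ j ∈ Finset.range n, (h m (ω j) - c)) / n := by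
    rw [Finset.sum_sub_distrib, Finset.sum_sub_distrib]
    simp only [Finset.sum_const, Finset.card_range, nsmul_eq_mul]
    field_simp
    ring
  have h3 : |(∑ j ∈ Finset.range n, (h m (ω j) - c)) / n| ≤ ε / 2 := by
    rw [abs_div, Nat.abs_cast, div_le_iff₀ hnp]
    refine (Finset.abs_sum_le_sum_abs _ _).trans ?_
    refine (Finset.sum_le_sum fun j _ => hm j).trans (le_of_eq ?_)
    simp [mul_comm]
  rw [e]
  exact lt_of_le_of_lt (abs_add_le _ _) (by linarith)

/-- Ergodicity in Theorem 2: for the contractive nonlinear closed loop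
`W ℓ (x, z) = (w ℓ x, A z + g ℓ x)` with `w ℓ` contractive, `g ℓ` globally Lipschitz and `A`
Schur, chosen with Dini continuous probabilities bounded below by `δ > 0`, with invariant
probability measure `μstar` for the associated Markov kernel, the time averages of any
bounded continuous observable along the Markov chain started at any `ξ₀` converge almost
surely to the space average `∫ f dμstar`; in particular the limit does not depend on `ξ₀`. -/
theorem nonlinear_two_ensemble_unique_ergodicity {nS nC L : ℕ}
    (A : Matrix (Fin nC) (Fin nC) ℝ) (hA : IsSchur A)
    (w : Fin L → EuclideanSpace ℝ (Fin nS) → EuclideanSpace ℝ (Fin nS))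
    (l : Fin L → NNReal) (hl : ∀ ℓ, l ℓ < 1) (hw : ∀ ℓ, LipschitzWith (l ℓ) (w ℓ))
    (g : Fin L → EuclideanSpace ℝ (Fin nS) → EuclideanSpace ℝ (Fin nC))
    (hg : ∀ ℓ, ∃ K : NNReal, LipschitzWith K (g ℓ))
    (W : Fin L → EuclideanSpace ℝ (Fin nS) × EuclideanSpace ℝ (Fin nC) →
      EuclideanSpace ℝ (Fin nS) × EuclideanSpace ℝ (Fin nC))
    (hW : ∀ ℓ x z, W ℓ (x, z) = (w ℓ x, Matrix.toEuclideanLin A z + g ℓ x))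
    (p : Fin L → EuclideanSpace ℝ (Fin nS) × EuclideanSpace ℝ (Fin nC) → ℝ)
    (hp01 : ∀ ℓ ξ, p ℓ ξ ∈ Set.Icc (0 : ℝ) 1)
    (hpDini : ∀ ℓ, DiniContinuous (p ℓ))
    (hpsum : ∀ ξ, ∑ ℓ, p ℓ ξ = 1)
    (δ : ℝ) (hδ : 0 < δ) (hplb : ∀ ℓ ξ, δ ≤ p ℓ ξ)
    (μstar : Measure (EuclideanSpace ℝ (Fin nS) × EuclideanSpace ℝ (Fin nC)))
    (hμstar : IsProbabilityMeasure μstar)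
    (hinv : Invariant (IFSKernel p W) μstar)
    (ξ₀ : EuclideanSpace ℝ (Fin nS) × EuclideanSpace ℝ (Fin nC))
    (P : Measure (ℕ → EuclideanSpace ℝ (Fin nS) × EuclideanSpace ℝ (Fin nC)))
    (hP : IsMarkovLaw (IFSKernel p W) ξ₀ P)
    (f : BoundedContinuousFunction (EuclideanSpace ℝ (Fin nS) × EuclideanSpace ℝ (Fin nC)) ℝ) :
    ∀ᵐ ω ∂P, Tendsto
      (fun k : ℕ => ((k : ℝ) + 1)⁻¹ * ∑ j ∈ Finset.range (k + 1), f (ω j))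
      atTop (𝓝 (∫ x, f x ∂μstar)) := by
  have hp0 : ∀ ℓ x, 0 ≤ p ℓ x := fun ℓ x => (hp01 ℓ x).1
  have hLpos : 0 < L := by
    rcases Nat.eq_zero_or_pos L with h | h
    · subst h; simpa using hpsum ξ₀
    · exact h
  have hδ1 : δ ≤ 1 := (hplb ⟨0, hLpos⟩ ξ₀).trans (hp01 _ _).2
  have hpc : ∀ ℓ, Continuous (p ℓ) := fun ℓ => dini_cont (hpDini ℓ)
  obtain ⟨m, hm, hTm⟩ := schur_pow A hA
  obtain ⟨N, C, r, hr, hr1, hC, hN1, hN2, hNadd, hNneg, hNW⟩ :=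
    closed_loop (Matrix.toEuclideanCLM (n := Fin nC) (𝕜 := ℝ) A) hm hTm w l hl hw g hg W
      (fun ℓ x z => hW ℓ x z)
  have hN0 : ∀ z, 0 ≤ N z := fun z => (norm_nonneg z).trans (hN1 z)
  have hWc : ∀ ℓ, Continuous (W ℓ) := by
    intro ℓ
    apply LipschitzWith.continuous (K := (r * C).toNNReal)
    apply LipschitzWith.of_dist_le_mul
    intro x y
    rw [Real.coe_toNNReal _ (by positivity), dist_eq_norm, dist_eq_norm]
    refine (hN1 _).trans ((hNW ℓ x y).trans ?_)
    rw [mul_assoc]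
    exact mul_le_mul_of_nonneg_left (hN2 _) hr.le
  have hNc : Continuous N := by
    apply LipschitzWith.continuous (K := C.toNNReal)
    apply LipschitzWith.of_le_add_mul
    intro x y
    rw [Real.coe_toNNReal _ hC, dist_eq_norm]
    have := hNadd y (x - y)
    rw [add_sub_cancel] at this
    linarith [hN2 (x - y)]
  choose φ hφm hφ0 hφi hφp using hpDini
  have hφnn : ∀ ℓ t, 0 ≤ t → 0 ≤ φ ℓ t := fun ℓ t ht => by
    rw [← hφ0 ℓ]; exact hφm ℓ (Set.mem_Ici.2 le_rfl) ht ht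
  obtain ⟨b, hb⟩ : ∃ b : ℝ, ∀ ℓ, N (W ℓ 0) ≤ b := by
    obtain ⟨B, hB⟩ := (Set.finite_range fun ℓ => N (W ℓ 0)).bddAbove
    exact ⟨B, fun ℓ => hB ⟨ℓ, rfl⟩⟩
  have hb0 : 0 ≤ b := (hN0 _).trans (hb ⟨0, hLpos⟩)
  let R0 := b / (1 - r)
  have hR0 : 0 ≤ R0 := div_nonneg hb0 (by linarith)
  have hKinv : ∀ R, R0 ≤ R → ∀ ℓ, ∀ x ∈ {x | N x ≤ R}, W ℓ x ∈ {x | N x ≤ R} := by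
    intro R hR ℓ x hx
    rw [Set.mem_ofPred_eq] at hx ⊢
    have h1 := hNadd (W ℓ x - W ℓ 0) (W ℓ 0)
    rw [sub_add_cancel] at h1
    have h2 := hNW ℓ x 0
    rw [sub_zero] at h2
    have h3 : b ≤ R * (1 - r) := (div_le_iff₀ (by linarith)).1 hR
    have h4 : r * N x ≤ r * R := by gcongr
    linarith [hb ℓ]
  have hKclosed : ∀ R, IsClosed {x | N x ≤ R} := fun R => isClosed_le hNc continuous_const
  have hKcomp : ∀ R, IsCompact {x | N x ≤ R} := by
    intro R
    apply Metric.isCompact_of_isClosed_isBounded (hKclosed R)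
    apply (Metric.isBounded_closedBall (x := 0) (r := R)).subset
    intro x hx
    rw [mem_closedBall_zero_iff]
    exact (hN1 x).trans hx
  have hfM : ∀ x, |f x| ≤ ‖f‖ := fun x => f.norm_coe_le_norm x
  have hfc : Continuous (fun x => f x) := f.continuous
  have hstab : ∀ R, R0 ≤ R → ∀ ε > 0, ∃ m0, ∀ m ≥ m0, ∀ x ∈ {x | N x ≤ R}, ∀ y ∈ {x | N x ≤ R},
      |(PU p W)^[m] (fun x => f x) x - (PU p W)^[m] (fun x => f x) y| ≤ ε := by
    intro R hR ε hε
    have hT0 : 0 ≤ 2 * R := by linarith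
    have hnn : ∀ i : ℕ, 0 ≤ ∑ ℓ, φ ℓ (r ^ i * (2 * R)) := fun i =>
      Finset.sum_nonneg fun ℓ _ => hφnn ℓ _ (by positivity)
    have hsum : Summable (fun i : ℕ => ∑ ℓ, φ ℓ (r ^ i * (2 * R))) :=
      summable_sum fun ℓ _ => dini_sum (hφm ℓ) (hφ0 ℓ) (hφi ℓ) hr hr1 hT0
    refine PU_stab hpc hWc hpsum hδ hδ1 hplb (hKcomp R) (hKinv R hR) (d := fun x y => N (x - y)) hr hr1
      (fun x y => by rw [dist_eq_norm]; exact hN1 _) (fun ℓ x y => hNW ℓ x y)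
      (Φ := fun t => ∑ ℓ, φ ℓ t) ?_ (T := 2 * R) (S := ∑' i : ℕ, ∑ ℓ, φ ℓ (r ^ i * (2 * R))) ?_ hnn ?_ hfc hfM hε
    · intro x y t ht
      apply Finset.sum_le_sum
      intro ℓ _
      have h1 : dist x y ≤ t := by rw [dist_eq_norm]; exact (hN1 _).trans ht
      exact (hφp ℓ x y).trans (hφm ℓ (Set.mem_Ici.2 dist_nonneg) (Set.mem_Ici.2 (dist_nonneg.trans h1)) h1)
    · intro x hx y hy
      rw [Set.mem_ofPred_eq] at hx hy
      have := hNadd x (-y)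
      rw [hNneg, ← sub_eq_add_neg] at this
      linarith
    · intro n
      exact hsum.sum_le_tsum _ (fun i _ => hnn i)
  have hUc : ∀ m, Continuous ((PU p W)^[m] (fun x => f x)) := fun m => PU_cont hpc hWc hfc m
  have hUb : ∀ m x, |(PU p W)^[m] (fun x => f x) x| ≤ ‖f‖ := fun m x => PU_iter_bound hp0 hpsum hfM m x
  have hpm : ∀ ℓ, Measurable (p ℓ) := fun ℓ => (hpc ℓ).measurable
  have hWm : ∀ ℓ, Measurable (W ℓ) := fun ℓ => (hWc ℓ).measurable
  set c := ∫ x, f x ∂μstar with hcdef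
  have hconv : Tendsto (fun m => (PU p W)^[m] (fun x => f x) ξ₀) atTop (𝓝 c) := by
    have hI : ∀ m, Integrable ((PU p W)^[m] (fun x => f x)) μstar := fun m =>
      Integrable.of_bound (hUc m).measurable.aestronglyMeasurable ‖f‖ (Eventually.of_forall (hUb m))
    have h1 : Tendsto (fun m => ∫ y, ((PU p W)^[m] (fun x => f x) ξ₀ - (PU p W)^[m] (fun x => f x) y) ∂μstar)
        atTop (𝓝 (∫ _, (0:ℝ) ∂μstar)) := by
      apply tendsto_integral_of_dominated_convergence (fun _ => ‖f‖ + ‖f‖)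
      · intro m
        exact (measurable_const.sub (hUc m).measurable).aestronglyMeasurable
      · exact integrable_const _
      · intro m
        refine Eventually.of_forall fun y => ?_
        exact (norm_sub_le _ _).trans (add_le_add (hUb m ξ₀) (hUb m y))
      · refine Eventually.of_forall fun y => ?_
        rw [Metric.tendsto_atTop]
        intro ε hε
        obtain ⟨m0, hm0⟩ := hstab (max R0 (max (N ξ₀) (N y))) (le_max_left _ _) (ε / 2) (by linarith)
        refine ⟨m0, fun m hm => ?_⟩
        have := hm0 m hm ξ₀
          (show N ξ₀ ≤ max R0 (max (N ξ₀) (N y)) from (le_max_left _ _).trans (le_max_right _ _)) y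
          (show N y ≤ max R0 (max (N ξ₀) (N y)) from (le_max_right _ _).trans (le_max_right _ _))
        rw [Real.dist_eq, sub_zero]
        linarith
    rw [integral_zero] at h1
    have h2 : ∀ m, ∫ y, ((PU p W)^[m] (fun x => f x) ξ₀ - (PU p W)^[m] (fun x => f x) y) ∂μstar
        = (PU p W)^[m] (fun x => f x) ξ₀ - c := by
      intro m
      rw [integral_sub (integrable_const _) (hI m), inv_PU hpm hWm hp0 hpsum hinv hfc.measurable hfM m]
      simp [hcdef]
    simp_rw [h2] at h1
    simpa using h1.add_const c
  let R1 := max R0 (N ξ₀)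
  have hunif : ∀ ε > 0, ∃ m, ∀ x ∈ {x | N x ≤ R1}, |(PU p W)^[m] (fun x => f x) x - c| ≤ ε := by
    intro ε hε
    obtain ⟨m0, hm0⟩ := hstab R1 (le_max_left _ _) (ε / 2) (by linarith)
    obtain ⟨m1, hm1⟩ := Metric.tendsto_atTop.1 hconv (ε / 2) (by linarith)
    refine ⟨max m0 m1, fun x hx => ?_⟩
    have a1 := hm0 _ (le_max_left m0 m1) x hx ξ₀ (le_max_right R0 (N ξ₀))
    have a2 := hm1 _ (le_max_right m0 m1)
    rw [Real.dist_eq] at a2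
    have := abs_sub_le ((PU p W)^[max m0 m1] (fun x => f x) x) ((PU p W)^[max m0 m1] (fun x => f x) ξ₀) c
    linarith
  have hinK := markov_inv hpm hWm hp0 hpsum hP (hKclosed R1).measurableSet
    (hKinv R1 (le_max_left _ _)) (le_max_right R0 (N ξ₀))
  have hslln : ∀ᵐ ω ∂P, ∀ m : ℕ, Tendsto (fun n : ℕ => (∑ j ∈ Finset.range n,
      ((PU p W)^[m] (fun x => f x) (ω (j + 1)) - (PU p W)^[m + 1] (fun x => f x) (ω j))) / n) atTop (𝓝 0) := by
    rw [ae_all_iff]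
    intro m
    have := markov_slln hpm hWm hp0 hpsum hP (hUc m).measurable (hUb m)
    simpa only [Function.iterate_succ_apply'] using this
  filter_upwards [hinK, hslln] with ω h1 h2
  have h3 := avg_aux ω (fun m => (PU p W)^[m] (fun x => f x)) hUb h2 (c := c) (fun ε hε => by
    obtain ⟨m, hm⟩ := hunif ε hε
    exact ⟨m, fun j => hm _ (h1 j)⟩)
  have h4 := h3.comp (tendsto_add_atTop_nat 1)
  refine h4.congr fun k => ?_
  simp only [Function.comp, Function.iterate_zero, id]
  push_cast
  rw [div_eq_inv_mul]
end
end
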